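/- The canonical surjection onto U⁺ from the ℂ-superalgebra presented by generators X⁺_{i,n} (1 ≤ i ≤ M+N−1, n ∈ ℤ, with X⁺_{M,n} odd and all others even) and only the relations (R4)–(R7) taken with the + sign, is an isomorphism of superalgebras; likewise U⁻ is isomorphic to the superalgebra presented by generators X⁻_{i,n} and relations (R4)–(R7) taken with the − sign. -/

import Mathlib

noncomputable section

namespace QAS

open Polynomial
open scoped TensorProduct

/-! ### Basic combinatorial data -/

/-- `l_i = 1` for `i ≤ M`, `-1` otherwise. -/
def lof (M : ℕ) (i : ℕ) : ℤ := if i ≤ M then 1 else -1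

/-- the bilinear form `(ε_i, ε_j) = l_i δ_{ij}`. -/
def innerE (M : ℕ) (i j : ℕ) : ℤ := if i = j then lof M i else 0

/-- `(ε_a − ε_b, ε_c − ε_d)`. -/
def form4 (M : ℕ) (a b c d : ℕ) : ℤ :=
  innerE M a c - innerE M a d - innerE M b c + innerE M b d

/-- the Cartan pairing `c_{ij} = (ε_i − ε_{i+1}, ε_j − ε_{j+1})`. -/
def cc (M : ℕ) (i j : ℕ) : ℤ := form4 M i (i + 1) j (j + 1)

/-- `q_i = q^{l_i}`. -/
def qpar (q : ℂ) (M : ℕ) (i : ℕ) : ℂ := q ^ lof M i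

/-- the quantum integer `[m]_v`. -/
def qint (v : ℂ) (m : ℤ) : ℂ := (v ^ m - v ^ (-m)) / (v - v⁻¹)

/-- the sign `(−1)^{|X_i||X_j|}` for the generators `X_i`, `X_j`. -/
def sgn (M : ℕ) (i j : ℕ) : ℂ := if i = M ∧ j = M then -1 else 1

/-- index set `1 ≤ i ≤ M+N−1`. -/
abbrev Idx (M N : ℕ) := {i : ℕ // 1 ≤ i ∧ i ≤ M + N - 1}

/-! ### Generators and the free superalgebra -/

/-- Drinfel'd generators; when `ext = true` we also have `K₀^{±1}`. -/
inductive Gen (M N : ℕ) (ext : Bool) : Type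
  | Xp : Idx M N → ℤ → Gen M N ext
  | Xm : Idx M N → ℤ → Gen M N ext
  | K : Idx M N → Gen M N ext
  | Ki : Idx M N → Gen M N ext
  | H : Idx M N → {s : ℤ // s ≠ 0} → Gen M N ext
  | K0 : ext = true → Gen M N ext
  | K0i : ext = true → Gen M N ext

abbrev FA (M N : ℕ) (ext : Bool) := FreeAlgebra ℂ (Gen M N ext)

def gi {M N : ℕ} {ext : Bool} (g : Gen M N ext) : FA M N ext := FreeAlgebra.ι ℂ g

def XpF (M N : ℕ) (ext : Bool) (i : ℕ) (n : ℤ) : FA M N ext :=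
  if h : 1 ≤ i ∧ i ≤ M + N - 1 then gi (Gen.Xp ⟨i, h⟩ n) else 0

def XmF (M N : ℕ) (ext : Bool) (i : ℕ) (n : ℤ) : FA M N ext :=
  if h : 1 ≤ i ∧ i ≤ M + N - 1 then gi (Gen.Xm ⟨i, h⟩ n) else 0

def KF (M N : ℕ) (ext : Bool) (i : ℕ) : FA M N ext :=
  if h : 1 ≤ i ∧ i ≤ M + N - 1 then gi (Gen.K ⟨i, h⟩) else 0

def KiF (M N : ℕ) (ext : Bool) (i : ℕ) : FA M N ext :=
  if h : 1 ≤ i ∧ i ≤ M + N - 1 then gi (Gen.Ki ⟨i, h⟩) else 0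

def HF (M N : ℕ) (ext : Bool) (i : ℕ) (s : ℤ) : FA M N ext :=
  if h : (1 ≤ i ∧ i ≤ M + N - 1) ∧ s ≠ 0 then gi (Gen.H ⟨i, h.1⟩ ⟨s, h.2⟩) else 0

def K0F (M N : ℕ) (ext : Bool) : FA M N ext :=
  if h : ext = true then gi (Gen.K0 h) else 0

def K0iF (M N : ℕ) (ext : Bool) : FA M N ext :=
  if h : ext = true then gi (Gen.K0i h) else 0

/-- coefficients of `exp (t · Σ_{s ≥ 1} a_s z^s)`. -/
def expC {A : Type} [Ring A] [Algebra ℂ A] (t : ℂ) (a : ℕ → A) : ℕ → A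
  | 0 => 1
  | n + 1 =>
      ((n : ℂ) + 1)⁻¹ •
        (t • ∑ s ∈ Finset.range (n + 1), ((s : ℂ) + 1) • (a (s + 1) * expC t a (n - s)))
termination_by n => n
decreasing_by omega

/-- `φ⁺_{i,n}`, the coefficient of `z^n` in
`K_i exp((q_i − q_i⁻¹) Σ_{s>0} h_{i,s} z^s)`. -/
def phiPF (q : ℂ) (M N : ℕ) (ext : Bool) (i : ℕ) (n : ℤ) : FA M N ext :=
  if 0 ≤ n then
    KF M N ext i *
      expC (qpar q M i - (qpar q M i)⁻¹) (fun s => HF M N ext i (s : ℤ)) n.toNat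
  else 0

/-- `φ⁻_{i,n}`, the coefficient of `z^n` (`n ≤ 0`) in
`K_i⁻¹ exp(−(q_i − q_i⁻¹) Σ_{s>0} h_{i,−s} z^{−s})`. -/
def phiMF (q : ℂ) (M N : ℕ) (ext : Bool) (i : ℕ) (n : ℤ) : FA M N ext :=
  if n ≤ 0 then
    KiF M N ext i *
      expC (-(qpar q M i - (qpar q M i)⁻¹)) (fun s => HF M N ext i (-(s : ℤ))) (-n).toNat
  else 0

/-- the `u`-bracket `[x,y]_u = xy − u·yx` (for `x` or `y` of even parity). -/
def brF {A : Type} [Ring A] [Module ℂ A] (u : ℂ) (x y : A) : A := x * y - u • (y * x)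

/-- the quartic oscillation expression
`[[[X_{M−1,m}, X_{M,n}]_{q⁻¹}, X_{M+1,k}]_q, X_{M,u}]` (a graded anticommutator in the
outermost bracket, both entries being odd). -/
def oscOf {A : Type} [Ring A] [Module ℂ A] (q : ℂ) (M : ℕ) (X : ℕ → ℤ → A) (m n k u : ℤ) : A :=
  brF q (brF q⁻¹ (X (M - 1) m) (X M n)) (X (M + 1) k) * X M u +
    X M u * brF q (brF q⁻¹ (X (M - 1) m) (X M n)) (X (M + 1) k)

/-! ### The defining relations.
`lvl = 1`: only (R1)–(R3);  `lvl = 2`: (R1)–(R5);  `lvl = 3`: all of (R1)–(R7).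
`ext = true` adds `K₀^{±1}` together with its relations. -/

inductive rel (q : ℂ) (M N : ℕ) (ext : Bool) (lvl : ℕ) : FA M N ext → FA M N ext → Prop
  | KKi (i : Idx M N) : rel q M N ext lvl (gi (Gen.K i) * gi (Gen.Ki i)) 1
  | KiK (i : Idx M N) : rel q M N ext lvl (gi (Gen.Ki i) * gi (Gen.K i)) 1
  | KK (i j : Idx M N) :
      rel q M N ext lvl (gi (Gen.K i) * gi (Gen.K j)) (gi (Gen.K j) * gi (Gen.K i))
  | KKi2 (i j : Idx M N) :
      rel q M N ext lvl (gi (Gen.K i) * gi (Gen.Ki j)) (gi (Gen.Ki j) * gi (Gen.K i))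
  | KiKi (i j : Idx M N) :
      rel q M N ext lvl (gi (Gen.Ki i) * gi (Gen.Ki j)) (gi (Gen.Ki j) * gi (Gen.Ki i))
  | KH (i j : Idx M N) (s : {s : ℤ // s ≠ 0}) :
      rel q M N ext lvl (gi (Gen.K i) * gi (Gen.H j s)) (gi (Gen.H j s) * gi (Gen.K i))
  | KiH (i j : Idx M N) (s : {s : ℤ // s ≠ 0}) :
      rel q M N ext lvl (gi (Gen.Ki i) * gi (Gen.H j s)) (gi (Gen.H j s) * gi (Gen.Ki i))
  | HH (i j : Idx M N) (s t : {s : ℤ // s ≠ 0}) :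
      rel q M N ext lvl (gi (Gen.H i s) * gi (Gen.H j t)) (gi (Gen.H j t) * gi (Gen.H i s))
  | KXp (i j : Idx M N) (n : ℤ) :
      rel q M N ext lvl (gi (Gen.K i) * gi (Gen.Xp j n))
        ((q ^ cc M i.1 j.1) • (gi (Gen.Xp j n) * gi (Gen.K i)))
  | KXm (i j : Idx M N) (n : ℤ) :
      rel q M N ext lvl (gi (Gen.K i) * gi (Gen.Xm j n))
        ((q ^ (-cc M i.1 j.1)) • (gi (Gen.Xm j n) * gi (Gen.K i)))
  | HXp (i j : Idx M N) (s : {s : ℤ // s ≠ 0}) (n : ℤ) :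
      rel q M N ext lvl
        (gi (Gen.H i s) * gi (Gen.Xp j n) - gi (Gen.Xp j n) * gi (Gen.H i s))
        ((qint (qpar q M i.1) (s.1 * lof M i.1 * cc M i.1 j.1) / (s.1 : ℂ)) •
          gi (Gen.Xp j (n + s.1)))
  | HXm (i j : Idx M N) (s : {s : ℤ // s ≠ 0}) (n : ℤ) :
      rel q M N ext lvl
        (gi (Gen.H i s) * gi (Gen.Xm j n) - gi (Gen.Xm j n) * gi (Gen.H i s))
        (-((qint (qpar q M i.1) (s.1 * lof M i.1 * cc M i.1 j.1) / (s.1 : ℂ)) •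
          gi (Gen.Xm j (n + s.1))))
  | XpXm (i j : Idx M N) (m n : ℤ) :
      rel q M N ext lvl
        (gi (Gen.Xp i m) * gi (Gen.Xm j n) -
          sgn M i.1 j.1 • (gi (Gen.Xm j n) * gi (Gen.Xp i m)))
        (if i = j then
            (qpar q M i.1 - (qpar q M i.1)⁻¹)⁻¹ •
              (phiPF q M N ext i.1 (m + n) - phiMF q M N ext i.1 (m + n))
          else 0)
  | XX0p (i j : Idx M N) (m n : ℤ) (h2 : 2 ≤ lvl) (h : cc M i.1 j.1 = 0) :
      rel q M N ext lvl
        (gi (Gen.Xp i m) * gi (Gen.Xp j n) -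
          sgn M i.1 j.1 • (gi (Gen.Xp j n) * gi (Gen.Xp i m))) 0
  | XX0m (i j : Idx M N) (m n : ℤ) (h2 : 2 ≤ lvl) (h : cc M i.1 j.1 = 0) :
      rel q M N ext lvl
        (gi (Gen.Xm i m) * gi (Gen.Xm j n) -
          sgn M i.1 j.1 • (gi (Gen.Xm j n) * gi (Gen.Xm i m))) 0
  | XXp (i j : Idx M N) (m n : ℤ) (h2 : 2 ≤ lvl) (h : cc M i.1 j.1 ≠ 0) :
      rel q M N ext lvl
        (gi (Gen.Xp i (m + 1)) * gi (Gen.Xp j n) -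
          (q ^ cc M i.1 j.1) • (gi (Gen.Xp j n) * gi (Gen.Xp i (m + 1))))
        ((q ^ cc M i.1 j.1) • (gi (Gen.Xp i m) * gi (Gen.Xp j (n + 1))) -
          gi (Gen.Xp j (n + 1)) * gi (Gen.Xp i m))
  | XXm (i j : Idx M N) (m n : ℤ) (h2 : 2 ≤ lvl) (h : cc M i.1 j.1 ≠ 0) :
      rel q M N ext lvl
        (gi (Gen.Xm i (m + 1)) * gi (Gen.Xm j n) -
          (q ^ (-cc M i.1 j.1)) • (gi (Gen.Xm j n) * gi (Gen.Xm i (m + 1))))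
        ((q ^ (-cc M i.1 j.1)) • (gi (Gen.Xm i m) * gi (Gen.Xm j (n + 1))) -
          gi (Gen.Xm j (n + 1)) * gi (Gen.Xm i m))
  | serreP (i j : Idx M N) (m n k : ℤ) (h3 : 3 ≤ lvl)
      (h : cc M i.1 j.1 = 1 ∨ cc M i.1 j.1 = -1) (hi : i.1 ≠ M) :
      rel q M N ext lvl
        (brF q (gi (Gen.Xp i m)) (brF q⁻¹ (gi (Gen.Xp i n)) (gi (Gen.Xp j k))) +
          brF q (gi (Gen.Xp i n)) (brF q⁻¹ (gi (Gen.Xp i m)) (gi (Gen.Xp j k)))) 0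
  | serreM (i j : Idx M N) (m n k : ℤ) (h3 : 3 ≤ lvl)
      (h : cc M i.1 j.1 = 1 ∨ cc M i.1 j.1 = -1) (hi : i.1 ≠ M) :
      rel q M N ext lvl
        (brF q (gi (Gen.Xm i m)) (brF q⁻¹ (gi (Gen.Xm i n)) (gi (Gen.Xm j k))) +
          brF q (gi (Gen.Xm i n)) (brF q⁻¹ (gi (Gen.Xm i m)) (gi (Gen.Xm j k)))) 0
  | oscP (m n k u : ℤ) (h3 : 3 ≤ lvl) (hM : 1 < M) (hN : 1 < N) :
      rel q M N ext lvl
        (oscOf q M (XpF M N ext) m n k u + oscOf q M (XpF M N ext) m u k n) 0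
  | oscM (m n k u : ℤ) (h3 : 3 ≤ lvl) (hM : 1 < M) (hN : 1 < N) :
      rel q M N ext lvl
        (oscOf q M (XmF M N ext) m n k u + oscOf q M (XmF M N ext) m u k n) 0
  | K0K0i (he : ext = true) : rel q M N ext lvl (gi (Gen.K0 he) * gi (Gen.K0i he)) 1
  | K0iK0 (he : ext = true) : rel q M N ext lvl (gi (Gen.K0i he) * gi (Gen.K0 he)) 1
  | K0K (he : ext = true) (i : Idx M N) :
      rel q M N ext lvl (gi (Gen.K0 he) * gi (Gen.K i)) (gi (Gen.K i) * gi (Gen.K0 he))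
  | K0Ki (he : ext = true) (i : Idx M N) :
      rel q M N ext lvl (gi (Gen.K0 he) * gi (Gen.Ki i)) (gi (Gen.Ki i) * gi (Gen.K0 he))
  | K0H (he : ext = true) (i : Idx M N) (s : {s : ℤ // s ≠ 0}) :
      rel q M N ext lvl (gi (Gen.K0 he) * gi (Gen.H i s)) (gi (Gen.H i s) * gi (Gen.K0 he))
  | K0Xp (he : ext = true) (i : Idx M N) (n : ℤ) :
      rel q M N ext lvl (gi (Gen.K0 he) * gi (Gen.Xp i n))
        ((q ^ (if i.1 = 1 then (1 : ℤ) else 0)) • (gi (Gen.Xp i n) * gi (Gen.K0 he)))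
  | K0Xm (he : ext = true) (i : Idx M N) (n : ℤ) :
      rel q M N ext lvl (gi (Gen.K0 he) * gi (Gen.Xm i n))
        ((q ^ (if i.1 = 1 then (-1 : ℤ) else 0)) • (gi (Gen.Xm i n) * gi (Gen.K0 he)))

/-! ### The quantum affine superalgebras -/

abbrev ALG (q : ℂ) (M N : ℕ) (ext : Bool) (lvl : ℕ) := RingQuot (rel q M N ext lvl)

def mkA (q : ℂ) (M N : ℕ) (ext : Bool) (lvl : ℕ) : FA M N ext →ₐ[ℂ] ALG q M N ext lvl :=
  RingQuot.mkAlgHom ℂ (rel q M N ext lvl)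

def XpA (q : ℂ) (M N : ℕ) (ext : Bool) (lvl : ℕ) (i : ℕ) (n : ℤ) : ALG q M N ext lvl :=
  mkA q M N ext lvl (XpF M N ext i n)

def XmA (q : ℂ) (M N : ℕ) (ext : Bool) (lvl : ℕ) (i : ℕ) (n : ℤ) : ALG q M N ext lvl :=
  mkA q M N ext lvl (XmF M N ext i n)

def KA (q : ℂ) (M N : ℕ) (ext : Bool) (lvl : ℕ) (i : ℕ) : ALG q M N ext lvl :=
  mkA q M N ext lvl (KF M N ext i)

def KiA (q : ℂ) (M N : ℕ) (ext : Bool) (lvl : ℕ) (i : ℕ) : ALG q M N ext lvl :=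
  mkA q M N ext lvl (KiF M N ext i)

def HA (q : ℂ) (M N : ℕ) (ext : Bool) (lvl : ℕ) (i : ℕ) (s : ℤ) : ALG q M N ext lvl :=
  mkA q M N ext lvl (HF M N ext i s)

def K0A (q : ℂ) (M N : ℕ) (ext : Bool) (lvl : ℕ) : ALG q M N ext lvl :=
  mkA q M N ext lvl (K0F M N ext)

def K0iA (q : ℂ) (M N : ℕ) (ext : Bool) (lvl : ℕ) : ALG q M N ext lvl :=
  mkA q M N ext lvl (K0iF M N ext)

def phiPA (q : ℂ) (M N : ℕ) (ext : Bool) (lvl : ℕ) (i : ℕ) (n : ℤ) : ALG q M N ext lvl :=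
  mkA q M N ext lvl (phiPF q M N ext i n)

def phiMA (q : ℂ) (M N : ℕ) (ext : Bool) (lvl : ℕ) (i : ℕ) (n : ℤ) : ALG q M N ext lvl :=
  mkA q M N ext lvl (phiMF q M N ext i n)

/-- `U⁺`: the subalgebra generated by the `X⁺_{i,n}`. -/
def Aplus (q : ℂ) (M N : ℕ) (ext : Bool) (lvl : ℕ) : Subalgebra ℂ (ALG q M N ext lvl) :=
  Algebra.adjoin ℂ {x | ∃ i : ℕ, ∃ n : ℤ, x = XpA q M N ext lvl i n}

/-- `U⁻`: the subalgebra generated by the `X⁻_{i,n}`. -/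
def Aminus (q : ℂ) (M N : ℕ) (ext : Bool) (lvl : ℕ) : Subalgebra ℂ (ALG q M N ext lvl) :=
  Algebra.adjoin ℂ {x | ∃ i : ℕ, ∃ n : ℤ, x = XmA q M N ext lvl i n}

/-- `U⁰`: the subalgebra generated by the `K_i^{±1}` and `h_{i,s}`. -/
def Azero (q : ℂ) (M N : ℕ) (ext : Bool) (lvl : ℕ) : Subalgebra ℂ (ALG q M N ext lvl) :=
  Algebra.adjoin ℂ {x | (∃ i : ℕ, x = KA q M N ext lvl i) ∨ (∃ i : ℕ, x = KiA q M N ext lvl i) ∨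
    ∃ i : ℕ, ∃ s : ℤ, x = HA q M N ext lvl i s}

/-- `U'⁰`: the subalgebra generated by `U⁰` and `K₀^{±1}`. -/
def AzeroE (q : ℂ) (M N : ℕ) (ext : Bool) (lvl : ℕ) : Subalgebra ℂ (ALG q M N ext lvl) :=
  Algebra.adjoin ℂ {x | (∃ i : ℕ, x = KA q M N ext lvl i) ∨ (∃ i : ℕ, x = KiA q M N ext lvl i) ∨
    (∃ i : ℕ, ∃ s : ℤ, x = HA q M N ext lvl i s) ∨ x = K0A q M N ext lvl ∨
      x = K0iA q M N ext lvl}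

/-! ### The multiplication map on the triple tensor product -/

def triMul (q : ℂ) (M N : ℕ) (ext : Bool) (lvl : ℕ)
    (S T R : Subalgebra ℂ (ALG q M N ext lvl)) :
    (↥S ⊗[ℂ] (↥T ⊗[ℂ] ↥R)) →ₗ[ℂ] ALG q M N ext lvl :=
  TensorProduct.lift
    (((LinearMap.mul ℂ (ALG q M N ext lvl)).comp S.val.toLinearMap).compl₂
      (TensorProduct.lift
        (((LinearMap.mul ℂ (ALG q M N ext lvl)).comp T.val.toLinearMap).compl₂
          R.val.toLinearMap)))

/-! ### Root vectors and PBW monomials -/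

def Xroot (q : ℂ) (M N : ℕ) (ext : Bool) (lvl : ℕ) (i : ℕ) : ℕ → ℤ → ALG q M N ext lvl
  | 0, n => XpA q M N ext lvl i n
  | k + 1, n =>
      brF (qpar q M (i + k + 1)) (Xroot q M N ext lvl i k n) (XpA q M N ext lvl (i + k + 1) 0)

/-- the root vector `X_{α_i + ⋯ + α_j}(n)`. -/
def XrootIJ (q : ℂ) (M N : ℕ) (ext : Bool) (lvl : ℕ) (i j : ℕ) (n : ℤ) : ALG q M N ext lvl :=
  Xroot q M N ext lvl i (j - i) n

def rootLE (a b : ℕ × ℕ) : Prop := a.1 < b.1 ∨ (a.1 = b.1 ∧ a.2 ≤ b.2)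

/-- the set of PBW ordered monomials in the root vectors. -/
def pbwSet (q : ℂ) (M N : ℕ) (ext : Bool) (lvl : ℕ) : Set (ALG q M N ext lvl) :=
  {x | ∃ L : List ((ℕ × ℕ) × ℤ),
      (∀ p ∈ L, 1 ≤ p.1.1 ∧ p.1.1 ≤ p.1.2 ∧ p.1.2 ≤ M + N - 1) ∧
      L.Chain' (fun a b => rootLE a.1 b.1) ∧
      x = (L.map fun p => XrootIJ q M N ext lvl p.1.1 p.1.2 p.2).prod}

/-- PBW ordered monomials of total degree `d` (`d i` counts the multiplicity of `α_i`). -/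
def pbwDegSet (q : ℂ) (M N : ℕ) (ext : Bool) (lvl : ℕ) (d : ℕ → ℕ) : Set (ALG q M N ext lvl) :=
  {x | ∃ L : List ((ℕ × ℕ) × ℤ),
      (∀ p ∈ L, 1 ≤ p.1.1 ∧ p.1.1 ≤ p.1.2 ∧ p.1.2 ≤ M + N - 1) ∧
      L.Chain' (fun a b => rootLE a.1 b.1) ∧
      (∀ i : ℕ, ((L.map fun p => if p.1.1 ≤ i ∧ i ≤ p.1.2 then 1 else 0).sum) = d i) ∧
      x = (L.map fun p => XrootIJ q M N ext lvl p.1.1 p.1.2 p.2).prod}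

/-- words in the generators `X⁺_{i,n}` of degree `d`. -/
def wordDegSet (q : ℂ) (M N : ℕ) (ext : Bool) (lvl : ℕ) (d : ℕ → ℕ) :
    Set (ALG q M N ext lvl) :=
  {x | ∃ w : List (ℕ × ℤ), (∀ p ∈ w, 1 ≤ p.1 ∧ p.1 ≤ M + N - 1) ∧
      (∀ i : ℕ, (w.map Prod.fst).count i = d i) ∧
      x = (w.map fun p => XpA q M N ext lvl p.1 p.2).prod}

/-! ### The subspaces `I^±_{i,j}` and `O^±` -/

def IElt (q : ℂ) (M N : ℕ) (ext : Bool) (lvl : ℕ) (pl : Bool) (i j : ℕ) (m n : ℤ) :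
    ALG q M N ext lvl :=
  let X : ℕ → ℤ → ALG q M N ext lvl := if pl then XpA q M N ext lvl else XmA q M N ext lvl
  let e : ℤ := if pl then cc M i j else -cc M i j
  if cc M i j = 0 then X i m * X j n - sgn M i j • (X j n * X i m)
  else
    X i (m + 1) * X j n - (q ^ e) • (X j n * X i (m + 1)) -
      (q ^ e) • (X i m * X j (n + 1)) + X j (n + 1) * X i m

def Isub (q : ℂ) (M N : ℕ) (ext : Bool) (lvl : ℕ) (pl : Bool) (i j : ℕ) :
    Submodule ℂ (ALG q M N ext lvl) :=
  Submodule.span ℂ (Set.range fun p : ℤ × ℤ => IElt q M N ext lvl pl i j p.1 p.2)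

def IsubAll (q : ℂ) (M N : ℕ) (ext : Bool) (lvl : ℕ) (pl : Bool) :
    Submodule ℂ (ALG q M N ext lvl) :=
  ⨆ p : ℕ × ℕ, ⨆ _ : 1 ≤ p.1 ∧ p.1 ≤ p.2 ∧ p.2 ≤ M + N - 1,
    Isub q M N ext lvl pl p.1 p.2

def OscElt (q : ℂ) (M N : ℕ) (ext : Bool) (lvl : ℕ) (pl : Bool) (m n k u : ℤ) :
    ALG q M N ext lvl :=
  let X : ℕ → ℤ → ALG q M N ext lvl := if pl then XpA q M N ext lvl else XmA q M N ext lvl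
  oscOf q M X m n k u + oscOf q M X m u k n

def Osub (q : ℂ) (M N : ℕ) (ext : Bool) (lvl : ℕ) (pl : Bool) :
    Submodule ℂ (ALG q M N ext lvl) :=
  Submodule.span ℂ
    (Set.range fun p : ℤ × ℤ × ℤ × ℤ => OscElt q M N ext lvl pl p.1 p.2.1 p.2.2.1 p.2.2.2)

/-- the sign `(−1)^{(p(α_k)+p(α_u))·p(α_i)}`. -/
def gsgn (M : ℕ) (k u i : ℕ) : ℂ :=
  if ((k = M ∧ ¬u = M) ∨ (¬k = M ∧ u = M)) ∧ i = M then -1 else 1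

/-! ### Highest weights and the associated eigenvalue sequences -/

/-- `Q·f = 0` for a bilateral formal series `f`. -/
def annih (Q : Polynomial ℂ) (f : ℤ → ℂ) : Prop :=
  ∀ n : ℤ, ∑ s ∈ Finset.range (Q.natDegree + 1), Q.coeff s * f (n - s) = 0

/-- an element of `R_{M,N}`: a highest weight `(P̲, f, c)`. -/
structure HW (q : ℂ) (M N : ℕ) : Type where
  P : ℕ → Polynomial ℂ
  f : ℤ → ℂ
  c : ℂ
  P_const : ∀ i, (P i).coeff 0 = 1
  c_ne : c ≠ 0
  torsion : ∃ Q : Polynomial ℂ, Q ≠ 0 ∧ annih Q f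
  f_zero : f 0 = (c - c⁻¹) / (q - q⁻¹)

def toPS (p : Polynomial ℂ) : PowerSeries ℂ := PowerSeries.mk fun n => p.coeff n

/-- `P(z·u)`. -/
def pscale (u : ℂ) (P : Polynomial ℂ) : Polynomial ℂ := P.comp (Polynomial.C u * Polynomial.X)

/-- the coefficient of `z^n` (`n ≥ 0`) in `q_i^{deg P} P(z q_i⁻¹)/P(z q_i)`,
expanded at `z = 0`. -/
def gammaP (q : ℂ) (M : ℕ) (i : ℕ) (P : Polynomial ℂ) (n : ℤ) : ℂ :=
  if 0 ≤ n then
    qpar q M i ^ P.natDegree *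
      PowerSeries.coeff n.toNat
        (toPS (pscale (qpar q M i)⁻¹ P) * (toPS (pscale (qpar q M i) P))⁻¹)
  else 0

/-- the coefficient of `z^n` (`n ≤ 0`) in `q_i^{deg P} P(z q_i⁻¹)/P(z q_i)`,
expanded at `z = ∞`. -/
def gammaM (q : ℂ) (M : ℕ) (i : ℕ) (P : Polynomial ℂ) (n : ℤ) : ℂ :=
  if n ≤ 0 then
    qpar q M i ^ P.natDegree *
      PowerSeries.coeff (-n).toNat
        (toPS ((pscale (qpar q M i)⁻¹ P).reflect P.natDegree) *
          (toPS ((pscale (qpar q M i) P).reflect P.natDegree))⁻¹)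
  else 0

/-! ### Verma, Weyl and simple modules -/

def vermaRels (q : ℂ) (M N : ℕ) (ext : Bool) (Λ : HW q M N) : Set (ALG q M N ext 3) :=
  {x | ∃ i : ℕ, ∃ n : ℤ, x = XpA q M N ext 3 i n} ∪
  {x | ∃ i : ℕ, ∃ n : ℤ, 1 ≤ i ∧ i ≤ M + N - 1 ∧ i ≠ M ∧
      (x = phiPA q M N ext 3 i n - algebraMap ℂ _ (gammaP q M i (Λ.P i) n) ∨
       x = phiMA q M N ext 3 i n - algebraMap ℂ _ (gammaM q M i (Λ.P i) n))} ∪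
  {x | x = KA q M N ext 3 M - algebraMap ℂ _ Λ.c} ∪
  {x | ∃ n : ℤ, x = phiPA q M N ext 3 M n - phiMA q M N ext 3 M n -
      algebraMap ℂ _ ((q - q⁻¹) * Λ.f n)} ∪
  {x | ext = true ∧ x = K0A q M N ext 3 - 1}

def evenRels (q : ℂ) (M N : ℕ) (ext : Bool) (Λ : HW q M N) : Set (ALG q M N ext 3) :=
  {x | ∃ i : ℕ, 1 ≤ i ∧ i ≤ M + N - 1 ∧ i ≠ M ∧
      x = XmA q M N ext 3 i 0 ^ (1 + (Λ.P i).natDegree)}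

def oddElt (q : ℂ) (M N : ℕ) (ext : Bool) (Q : Polynomial ℂ) (n : ℤ) : ALG q M N ext 3 :=
  ∑ s ∈ Finset.range (Q.natDegree + 1),
    Q.coeff (Q.natDegree - s) • XmA q M N ext 3 M ((s : ℤ) + n)

def oddRels (q : ℂ) (M N : ℕ) (ext : Bool) (Q : Polynomial ℂ) : Set (ALG q M N ext 3) :=
  if M = 1 ∧ N = 1 then {x | ∃ n : ℤ, x = oddElt q M N ext Q n}
  else {oddElt q M N ext Q 0}

def vermaIdeal (q : ℂ) (M N : ℕ) (ext : Bool) (Λ : HW q M N) : Ideal (ALG q M N ext 3) :=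
  Ideal.span (vermaRels q M N ext Λ)

def weylIdeal (q : ℂ) (M N : ℕ) (ext : Bool) (Λ : HW q M N) (Q : Polynomial ℂ) :
    Ideal (ALG q M N ext 3) :=
  Ideal.span (vermaRels q M N ext Λ ∪ evenRels q M N ext Λ ∪ oddRels q M N ext Q)

def uweylIdeal (q : ℂ) (M N : ℕ) (ext : Bool) (Λ : HW q M N) : Ideal (ALG q M N ext 3) :=
  Ideal.span (vermaRels q M N ext Λ ∪ evenRels q M N ext Λ)

/-- the Verma module `M(Λ)`. -/
def VermaMod (q : ℂ) (M N : ℕ) (ext : Bool) (Λ : HW q M N) : Type :=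
  ALG q M N ext 3 ⧸ vermaIdeal q M N ext Λ

/-- the Weyl module `W(Λ; Q)`. -/
def WeylMod (q : ℂ) (M N : ℕ) (ext : Bool) (Λ : HW q M N) (Q : Polynomial ℂ) : Type :=
  ALG q M N ext 3 ⧸ weylIdeal q M N ext Λ Q

/-- the universal Weyl module `W(Λ)`. -/
def UWeylMod (q : ℂ) (M N : ℕ) (ext : Bool) (Λ : HW q M N) : Type :=
  ALG q M N ext 3 ⧸ uweylIdeal q M N ext Λ

instance (q : ℂ) (M N : ℕ) (ext : Bool) (Λ : HW q M N) : AddCommGroup (VermaMod q M N ext Λ) :=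
  inferInstanceAs (AddCommGroup (ALG q M N ext 3 ⧸ vermaIdeal q M N ext Λ))
instance (q : ℂ) (M N : ℕ) (ext : Bool) (Λ : HW q M N) :
    Module (ALG q M N ext 3) (VermaMod q M N ext Λ) :=
  inferInstanceAs (Module (ALG q M N ext 3) (ALG q M N ext 3 ⧸ vermaIdeal q M N ext Λ))
instance (q : ℂ) (M N : ℕ) (ext : Bool) (Λ : HW q M N) : Module ℂ (VermaMod q M N ext Λ) :=
  inferInstanceAs (Module ℂ (ALG q M N ext 3 ⧸ vermaIdeal q M N ext Λ))
instance (q : ℂ) (M N : ℕ) (ext : Bool) (Λ : HW q M N) :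
    IsScalarTower ℂ (ALG q M N ext 3) (VermaMod q M N ext Λ) :=
  inferInstanceAs (IsScalarTower ℂ (ALG q M N ext 3) (ALG q M N ext 3 ⧸ vermaIdeal q M N ext Λ))

instance (q : ℂ) (M N : ℕ) (ext : Bool) (Λ : HW q M N) (Q : Polynomial ℂ) :
    AddCommGroup (WeylMod q M N ext Λ Q) :=
  inferInstanceAs (AddCommGroup (ALG q M N ext 3 ⧸ weylIdeal q M N ext Λ Q))
instance (q : ℂ) (M N : ℕ) (ext : Bool) (Λ : HW q M N) (Q : Polynomial ℂ) :
    Module (ALG q M N ext 3) (WeylMod q M N ext Λ Q) :=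
  inferInstanceAs (Module (ALG q M N ext 3) (ALG q M N ext 3 ⧸ weylIdeal q M N ext Λ Q))
instance (q : ℂ) (M N : ℕ) (ext : Bool) (Λ : HW q M N) (Q : Polynomial ℂ) :
    Module ℂ (WeylMod q M N ext Λ Q) :=
  inferInstanceAs (Module ℂ (ALG q M N ext 3 ⧸ weylIdeal q M N ext Λ Q))
instance (q : ℂ) (M N : ℕ) (ext : Bool) (Λ : HW q M N) (Q : Polynomial ℂ) :
    IsScalarTower ℂ (ALG q M N ext 3) (WeylMod q M N ext Λ Q) :=
  inferInstanceAs
    (IsScalarTower ℂ (ALG q M N ext 3) (ALG q M N ext 3 ⧸ weylIdeal q M N ext Λ Q))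

instance (q : ℂ) (M N : ℕ) (ext : Bool) (Λ : HW q M N) : AddCommGroup (UWeylMod q M N ext Λ) :=
  inferInstanceAs (AddCommGroup (ALG q M N ext 3 ⧸ uweylIdeal q M N ext Λ))
instance (q : ℂ) (M N : ℕ) (ext : Bool) (Λ : HW q M N) :
    Module (ALG q M N ext 3) (UWeylMod q M N ext Λ) :=
  inferInstanceAs (Module (ALG q M N ext 3) (ALG q M N ext 3 ⧸ uweylIdeal q M N ext Λ))
instance (q : ℂ) (M N : ℕ) (ext : Bool) (Λ : HW q M N) : Module ℂ (UWeylMod q M N ext Λ) :=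
  inferInstanceAs (Module ℂ (ALG q M N ext 3 ⧸ uweylIdeal q M N ext Λ))
instance (q : ℂ) (M N : ℕ) (ext : Bool) (Λ : HW q M N) :
    IsScalarTower ℂ (ALG q M N ext 3) (UWeylMod q M N ext Λ) :=
  inferInstanceAs (IsScalarTower ℂ (ALG q M N ext 3) (ALG q M N ext 3 ⧸ uweylIdeal q M N ext Λ))

/-- the highest weight vector (image of `1`). -/
def vgen (q : ℂ) (M N : ℕ) (Λ : HW q M N) : VermaMod q M N true Λ :=
  Submodule.Quotient.mk 1

/-- the sum of all submodules not containing the highest weight vector (the unique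
maximal submodule of the Verma module). -/
def radV (q : ℂ) (M N : ℕ) (Λ : HW q M N) :
    Submodule (ALG q M N true 3) (VermaMod q M N true Λ) :=
  sSup {p | vgen q M N Λ ∉ p}

/-- the simple quotient `S'(Λ)`. -/
def SimpMod (q : ℂ) (M N : ℕ) (Λ : HW q M N) : Type :=
  VermaMod q M N true Λ ⧸ radV q M N Λ

instance (q : ℂ) (M N : ℕ) (Λ : HW q M N) : AddCommGroup (SimpMod q M N Λ) :=
  inferInstanceAs (AddCommGroup (VermaMod q M N true Λ ⧸ radV q M N Λ))
instance (q : ℂ) (M N : ℕ) (Λ : HW q M N) :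
    Module (ALG q M N true 3) (SimpMod q M N Λ) :=
  inferInstanceAs (Module (ALG q M N true 3) (VermaMod q M N true Λ ⧸ radV q M N Λ))
instance (q : ℂ) (M N : ℕ) (Λ : HW q M N) : Module ℂ (SimpMod q M N Λ) :=
  inferInstanceAs (Module ℂ (VermaMod q M N true Λ ⧸ radV q M N Λ))
instance (q : ℂ) (M N : ℕ) (Λ : HW q M N) :
    IsScalarTower ℂ (ALG q M N true 3) (SimpMod q M N Λ) :=
  inferInstanceAs (IsScalarTower ℂ (ALG q M N true 3) (VermaMod q M N true Λ ⧸ radV q M N Λ))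

/-! ### Weight spaces -/

/-- `K_i` for `0 ≤ i`, with `K₀` at `i = 0`. -/
def Kgen (q : ℂ) (M N : ℕ) (ext : Bool) (lvl : ℕ) (i : ℕ) : ALG q M N ext lvl :=
  if i = 0 then K0A q M N ext lvl else KA q M N ext lvl i

/-- the `μ`-weight space of a module. -/
def wtSp (q : ℂ) (M N : ℕ) (ext : Bool) {W : Type} [AddCommGroup W] [Module ℂ W]
    [Module (ALG q M N ext 3) W] [IsScalarTower ℂ (ALG q M N ext 3) W] (μ : ℕ → ℂ) :
    Submodule ℂ W where
  carrier := {w | ∀ i < M + N, Kgen q M N ext 3 i • w = μ i • w}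
  add_mem' := by
    intro a b ha hb i hi
    rw [smul_add, ha i hi, hb i hi, smul_add]
  zero_mem' := by
    intro i hi
    rw [smul_zero, smul_zero]
  smul_mem' := by
    intro c w hw i hi
    have h1 : Kgen q M N ext 3 i • (c • w) = c • (Kgen q M N ext 3 i • w) := by
      rw [← algebraMap_smul (ALG q M N ext 3) c w, ← mul_smul, ← Algebra.commutes, mul_smul,
        algebraMap_smul]
    rw [h1, hw i hi, smul_comm]

/-- the character `λ_Λ`. -/
def lamF (q : ℂ) (M N : ℕ) (Λ : HW q M N) : ℕ → ℂ :=
  fun i => if i = 0 then 1 else if i = M then Λ.c else qpar q M i ^ (Λ.P i).natDegree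

/-- the character `α_j`. -/
def alF (q : ℂ) (M : ℕ) (j : ℕ) : ℕ → ℂ :=
  fun i => if i = 0 then (if j = 1 then q else 1) else q ^ cc M j i

/-! ### The generators of `U` inside `U'` -/

def UGenSet (q : ℂ) (M N : ℕ) : Set (ALG q M N true 3) :=
  {x | (∃ i : ℕ, ∃ n : ℤ, x = XpA q M N true 3 i n) ∨
    (∃ i : ℕ, ∃ n : ℤ, x = XmA q M N true 3 i n) ∨
    (∃ i : ℕ, x = KA q M N true 3 i) ∨ (∃ i : ℕ, x = KiA q M N true 3 i) ∨
    ∃ i : ℕ, ∃ s : ℤ, x = HA q M N true 3 i s}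

/-! ### One-sided presentations (for `U^±`) -/

def XgF (M N : ℕ) (i : ℕ) (n : ℤ) : FreeAlgebra ℂ (Idx M N × ℤ) :=
  if h : 1 ≤ i ∧ i ≤ M + N - 1 then FreeAlgebra.ι ℂ ((⟨i, h⟩, n) : Idx M N × ℤ) else 0

inductive rel1 (q : ℂ) (M N : ℕ) (pl : Bool) :
    FreeAlgebra ℂ (Idx M N × ℤ) → FreeAlgebra ℂ (Idx M N × ℤ) → Prop
  | comm0 (i j : Idx M N) (m n : ℤ) (h : cc M i.1 j.1 = 0) :
      rel1 q M N pl
        (FreeAlgebra.ι ℂ ((i, m) : Idx M N × ℤ) * FreeAlgebra.ι ℂ ((j, n) : Idx M N × ℤ) -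
          sgn M i.1 j.1 •
            (FreeAlgebra.ι ℂ ((j, n) : Idx M N × ℤ) * FreeAlgebra.ι ℂ ((i, m) : Idx M N × ℤ))) 0
  | deg2 (i j : Idx M N) (m n : ℤ) (h : cc M i.1 j.1 ≠ 0) :
      rel1 q M N pl
        (FreeAlgebra.ι ℂ ((i, m + 1) : Idx M N × ℤ) * FreeAlgebra.ι ℂ ((j, n) : Idx M N × ℤ) -
          (q ^ (if pl then cc M i.1 j.1 else -cc M i.1 j.1)) •
            (FreeAlgebra.ι ℂ ((j, n) : Idx M N × ℤ) *
              FreeAlgebra.ι ℂ ((i, m + 1) : Idx M N × ℤ)))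
        ((q ^ (if pl then cc M i.1 j.1 else -cc M i.1 j.1)) •
            (FreeAlgebra.ι ℂ ((i, m) : Idx M N × ℤ) *
              FreeAlgebra.ι ℂ ((j, n + 1) : Idx M N × ℤ)) -
          FreeAlgebra.ι ℂ ((j, n + 1) : Idx M N × ℤ) * FreeAlgebra.ι ℂ ((i, m) : Idx M N × ℤ))
  | serre (i j : Idx M N) (m n k : ℤ) (h : cc M i.1 j.1 = 1 ∨ cc M i.1 j.1 = -1)
      (hi : i.1 ≠ M) :
      rel1 q M N pl
        (brF q (FreeAlgebra.ι ℂ ((i, m) : Idx M N × ℤ))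
            (brF q⁻¹ (FreeAlgebra.ι ℂ ((i, n) : Idx M N × ℤ))
              (FreeAlgebra.ι ℂ ((j, k) : Idx M N × ℤ))) +
          brF q (FreeAlgebra.ι ℂ ((i, n) : Idx M N × ℤ))
            (brF q⁻¹ (FreeAlgebra.ι ℂ ((i, m) : Idx M N × ℤ))
              (FreeAlgebra.ι ℂ ((j, k) : Idx M N × ℤ)))) 0
  | osc (m n k u : ℤ) (hM : 1 < M) (hN : 1 < N) :
      rel1 q M N pl (oscOf q M (XgF M N) m n k u + oscOf q M (XgF M N) m u k n) 0

end QAS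

set_option linter.all false
set_option linter.unusedSectionVars false
set_option linter.unusedSimpArgs false
namespace QAS

/-! ### Formal currents: functions of four modes as a module over shift operators -/

abbrev G4 := Fin 4 → ℤ
abbrev RS := AddMonoidAlgebra ℂ G4

/-- `A`-valued functions of four integer modes. -/
def WF (A : Type) := G4 → A

instance (A : Type) [Ring A] : AddCommGroup (WF A) := inferInstanceAs (AddCommGroup (G4 → A))
instance (A : Type) [Ring A] [Algebra ℂ A] : Module ℂ (WF A) :=
  inferInstanceAs (Module ℂ (G4 → A))

/-- translation of the modes. -/
def shiftHom (A : Type) [Ring A] [Algebra ℂ A] : Multiplicative G4 →* Module.End ℂ (WF A) where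
  toFun g :=
    { toFun := fun f m => f (m + g.toAdd)
      map_add' := fun _ _ => rfl
      map_smul' := fun _ _ => rfl }
  map_one' := by
    ext f
    funext m
    show f (m + 0) = f m
    rw [add_zero]
  map_mul' g h := by
    ext f
    funext m
    show f (m + (g.toAdd + h.toAdd)) = f (m + g.toAdd + h.toAdd)
    rw [add_assoc]

def shiftAlg (A : Type) [Ring A] [Algebra ℂ A] : RS →ₐ[ℂ] Module.End ℂ (WF A) :=
  AddMonoidAlgebra.lift ℂ (Module.End ℂ (WF A)) G4 (shiftHom A)

instance (A : Type) [Ring A] [Algebra ℂ A] : Module RS (WF A) :=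
  Module.compHom (WF A) (shiftAlg A).toRingHom

/-- the variable attached to the `i`-th mode. -/
def zv (i : Fin 4) : RS := AddMonoidAlgebra.single (Pi.single i 1) 1
/-- scalars. -/
def cs (a : ℂ) : RS := algebraMap ℂ RS a

variable {A : Type} [Ring A] [Algebra ℂ A]

theorem wf_smul_def (a : RS) (f : WF A) : a • f = shiftAlg A a f := rfl

theorem zv_smul (i : Fin 4) (f : WF A) (m : G4) :
    (zv i • f) m = f (m + Pi.single i 1) := by
  rw [wf_smul_def, shiftAlg, zv, AddMonoidAlgebra.lift_single, one_smul]
  rfl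

theorem cs_smul (a : ℂ) (f : WF A) (m : G4) : (cs a • f) m = a • f m := by
  rw [wf_smul_def, cs, AlgHom.commutes]
  rfl

theorem cs_zv_smul (a : ℂ) (i : Fin 4) (f : WF A) (m : G4) :
    ((cs a * zv i) • f) m = a • f (m + Pi.single i 1) := by
  rw [mul_smul, cs_smul, zv_smul]

theorem wf_add_apply (f g : WF A) (m : G4) : (f + g) m = f m + g m := rfl
theorem wf_sub_apply (f g : WF A) (m : G4) : (f - g) m = f m - g m := rfl
theorem wf_zero_apply (m : G4) : (0 : WF A) m = 0 := rfl
theorem wf_neg_apply (f : WF A) (m : G4) : (-f) m = - f m := rfl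

/-- word in the given currents. -/
def word (l : List ((ℤ → A) × Fin 4)) : WF A :=
  fun m => (l.map (fun p => p.1 (m p.2))).prod

theorem word_inv (l : List ((ℤ → A) × Fin 4)) (i : Fin 4) (h : ∀ p ∈ l, p.2 ≠ i) (m : G4) :
    word l (m + Pi.single i 1) = word l m := by
  unfold word
  congr 1
  apply List.map_congr_left
  intro p hp
  simp [Pi.single_apply, h p hp]

theorem word_append (l l' : List ((ℤ → A) × Fin 4)) (m : G4) :
    word (l ++ l') m = word l m * word l' m := by
  simp [word]

theorem word_cons (p : (ℤ → A) × Fin 4) (l' : List ((ℤ → A) × Fin 4)) (m : G4) :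
    word (p :: l') m = p.1 (m p.2) * word l' m := by
  simp [word]

theorem word_nil (m : G4) : word ([] : List ((ℤ → A) × Fin 4)) m = 1 := by
  simp [word]

/-- `(α z - β w) x(z) y(w) = (β z - α w) y(w) x(z)` in modes. -/
def Ex (α β : ℂ) (x y : ℤ → A) : Prop :=
  ∀ m n : ℤ, α • (x (m + 1) * y n) - β • (y n * x (m + 1)) =
    β • (x m * y (n + 1)) - α • (y (n + 1) * x m)

theorem exch {α β : ℂ} {x y : ℤ → A} (hx : Ex α β x y) (i j : Fin 4)
    (L R : List ((ℤ → A) × Fin 4)) (hij : i ≠ j := by decide)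
    (hLi : ∀ p ∈ L, p.2 ≠ i := by simp) (hLj : ∀ p ∈ L, p.2 ≠ j := by simp)
    (hRi : ∀ p ∈ R, p.2 ≠ i := by simp) (hRj : ∀ p ∈ R, p.2 ≠ j := by simp) :
    (cs α * zv i - cs β * zv j) • word (L ++ (x, i) :: (y, j) :: R) =
      (cs β * zv i - cs α * zv j) • word (L ++ (y, j) :: (x, i) :: R) := by
  rw [sub_smul, sub_smul]
  funext m
  have h := congrArg (fun a => word L m * a * word R m) (hx (m i) (m j))
  simp only [wf_sub_apply, cs_zv_smul, word_append, word_cons, Pi.add_apply, Pi.single_apply,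
    if_true, if_neg hij, if_neg hij.symm, add_zero, word_inv L i hLi, word_inv L j hLj,
    word_inv R i hRi, word_inv R j hRj]
  simp only [mul_sub, sub_mul, mul_smul_comm, smul_mul_assoc, mul_assoc] at h ⊢
  linear_combination (norm := module) h

theorem swapC {x y : ℤ → A} (hx : ∀ m n, x m * y n = y n * x m) (i j : Fin 4)
    (L R : List ((ℤ → A) × Fin 4)) :
    word (L ++ (x, i) :: (y, j) :: R) = word (L ++ (y, j) :: (x, i) :: R) := by
  funext m
  simp only [word_append, word_cons]
  rw [← mul_assoc (x _), hx, mul_assoc]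

theorem swapN {x y : ℤ → A} (hx : ∀ m n, x m * y n = - (y n * x m)) (i j : Fin 4)
    (L R : List ((ℤ → A) × Fin 4)) :
    word (L ++ (x, i) :: (y, j) :: R) = - word (L ++ (y, j) :: (x, i) :: R) := by
  funext m
  simp only [word_append, word_cons, wf_neg_apply]
  rw [← mul_assoc (x _), hx]
  simp only [neg_mul, mul_neg, mul_assoc]

def Bdd (Y : ℤ → A) : Prop := ∃ B : ℤ, (∀ n < B, Y n = 0) ∨ (∀ n > B, Y n = 0)

def BddW (f : WF A) : Prop := ∃ B : ℤ, (∀ m : G4, m 0 < B → f m = 0) ∨ (∀ m : G4, B < m 0 → f m = 0)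

theorem BddW.smul0 {f : WF A} (hf : BddW f) (α β : ℂ) (i : Fin 4) (hi : i ≠ 0) :
    BddW ((cs α * zv 0 - cs β * zv i) • f) := by
  obtain ⟨B, h | h⟩ := hf
  · refine ⟨B - 1, Or.inl fun m hm => ?_⟩
    rw [sub_smul, wf_sub_apply, cs_zv_smul, cs_zv_smul, h, h] <;>
      simp [Pi.single_apply, hi.symm] <;> omega
  · refine ⟨B, Or.inr fun m hm => ?_⟩
    rw [sub_smul, wf_sub_apply, cs_zv_smul, cs_zv_smul, h, h] <;>
      simp [Pi.single_apply, hi.symm] <;> omega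

theorem cancel {f : WF A} (hf : BddW f) {α β : ℂ} (hα : α ≠ 0) (hβ : β ≠ 0) {i : Fin 4}
    (hi : i ≠ 0) (h : (cs α * zv 0 - cs β * zv i) • f = 0) : f = 0 := by
  have key : ∀ m : G4, α • f (m + Pi.single 0 1) = β • f (m + Pi.single i 1) := by
    intro m
    have := congrFun h m
    rw [sub_smul, wf_sub_apply, cs_zv_smul, cs_zv_smul, wf_zero_apply, sub_eq_zero] at this
    exact this
  have up : ∀ m : G4, f (m - Pi.single 0 1 + Pi.single i 1) = 0 → f m = 0 := by
    intro m hm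
    have := key (m - Pi.single 0 1)
    rw [hm, smul_zero, sub_add_cancel] at this
    exact (smul_eq_zero_iff_right hα).1 this
  have down : ∀ m : G4, f (m - Pi.single i 1 + Pi.single 0 1) = 0 → f m = 0 := by
    intro m hm
    have := key (m - Pi.single i 1)
    rw [hm, smul_zero, sub_add_cancel] at this
    exact (smul_eq_zero_iff_right hβ).1 this.symm
  obtain ⟨B, hB | hB⟩ := hf
  · have : ∀ k : ℕ, ∀ m : G4, m 0 < B + k → f m = 0 := by
      intro k
      induction k with
      | zero => intro m hm; exact hB m (by simpa using hm)
      | succ k ih =>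
        intro m hm
        apply up
        apply ih
        simp [Pi.single_apply, hi.symm]
        push_cast at hm
        omega
    funext m
    exact this (m 0 - B + 1).toNat m (by omega)
  · have : ∀ k : ℕ, ∀ m : G4, B - k < m 0 → f m = 0 := by
      intro k
      induction k with
      | zero => intro m hm; exact hB m (by simpa using hm)
      | succ k ih =>
        intro m hm
        apply down
        apply ih
        simp [Pi.single_apply, hi.symm]
        push_cast at hm
        omega
    funext m
    exact this (B - m 0 + 1).toNat m (by omega)

theorem BddW.word {Y : ℤ → A} (hY : Bdd Y) (f : WF A) (hf : ∀ m, Y (m 0) = 0 → f m = 0) :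
    BddW f := by
  obtain ⟨B, h | h⟩ := hY
  · exact ⟨B, Or.inl fun m hm => hf m (h _ hm)⟩
  · exact ⟨B, Or.inr fun m hm => hf m (h _ hm)⟩

end QAS

set_option linter.all false
set_option linter.unusedSectionVars false
set_option linter.unusedSimpArgs false
namespace QAS
variable {A : Type} [Ring A] [Algebra ℂ A]

theorem Ex.symm {α β : ℂ} {x y : ℤ → A} (h : Ex α β x y) : Ex α β y x := by
  intro m n
  linear_combination (norm := module) h n m

theorem Ex.scale {α β : ℂ} {x y : ℤ → A} (h : Ex α β x y) (c : ℂ) : Ex (c * α) (c * β) x y := by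
  intro m n
  linear_combination (norm := module) c • h m n

theorem cs_one : cs 1 = 1 := map_one _
theorem cs_mul (a b : ℂ) : cs (a * b) = cs a * cs b := by simp [cs]
theorem cs_add (a b : ℂ) : cs (a + b) = cs a + cs b := by simp [cs]

/-- the commutation of `Y` with a current when the exchange function is trivial. -/
theorem comm_of_Ex {Y x : ℤ → A} (hY : Bdd Y) (h : Ex 1 1 Y x) (m n : ℤ) :
    Y m * x n = x n * Y m := by
  have h1 : (cs 1 * zv 0 - cs 1 * zv 1) • (word [(Y, 0), (x, 1)] - word [(x, 1), (Y, 0)]) = 0 := by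
    have := exch h 0 1 [] []
    simp only [List.nil_append] at this
    rw [smul_sub, this, sub_self]
  have h2 := cancel (BddW.word hY _ ?_) one_ne_zero one_ne_zero (by decide) h1
  · have := congrFun h2 ![m, n, 0, 0]
    simpa [wf_sub_apply, word_cons, word_nil, wf_zero_apply, sub_eq_zero] using this
  · intro m hm
    simp [wf_sub_apply, word_cons, word_nil, hm]

theorem pure6j {W : Type} [AddCommGroup W] [Module RS W] (r u z w : RS)
    (Yab Yba aYb bYa abY baY : W)
    (h1 : (u - r * w) • aYb = (r * u - w) • abY)
    (h2 : (u - r * z) • Yab = (r * u - z) • aYb)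
    (h3 : (u - r * z) • bYa = (r * u - z) • baY)
    (h4 : (u - r * w) • Yba = (r * u - w) • bYa)
    (h5 : (r * r * z - w) • Yab = (z - r * r * w) • Yba) :
    (r * u - z) • (r * u - w) •
      (r • (abY + baY) - (r * r + 1) • (aYb + bYa) + r • (Yab + Yba)) = 0 := by
  linear_combination (norm := module) (-r * (r * u - z)) • h1 + (-r * (r * u - w)) • h3
    + (-(r * (u - r * w)) + (r * r + 1) * (r * u - w)) • h2
    + (-(r * (u - r * z)) + (r * r + 1) * (r * u - z)) • h4 + (-(u * (1 - r * r))) • h5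

theorem pure6i {W : Type} [AddCommGroup W] [Module RS W] (r u z w : RS)
    (Yab Yba aYb bYa abY baY : W)
    (h1 : (u - r * w) • aYb = (r * u - w) • abY)
    (h2 : (r * r * u - z) • Yab = (u - r * r * z) • aYb)
    (h3 : (r * r * u - z) • bYa = (u - r * r * z) • baY)
    (h4 : (u - r * w) • Yba = (r * u - w) • bYa)
    (h5 : (z - r * w) • Yab = (r * z - w) • Yba) :
    (u - r * r * z) • (r * u - w) •
      (r • (Yab + aYb) - (r * r + 1) • (Yba + abY) + r • (bYa + baY)) = 0 := by
  linear_combination (norm := module) ((r * r + 1) * (u - r * r * z)) • h1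
    + (-r * (r * u - w)) • h3
    + (-(r * (r * u - w)) + (r * r + 1) * (u - r * w)) • h2
    + (-(r * (u - r * r * z)) - r * (r * r * u - z)) • h4
    + (-(u * (r * r * r * r - 1))) • h5

theorem T6j {r : ℂ} (hr : r ≠ 0) {Y x : ℤ → A} (hY : Bdd Y) (hYx : Ex 1 r Y x)
    (hxx : Ex (r * r) 1 x x) (k m n : ℤ) :
    r • (x m * (x n * Y k) + x n * (x m * Y k)) - (r * r + 1) • (x m * (Y k * x n) + x n * (Y k * x m))
      + r • (Y k * (x m * x n) + Y k * (x n * x m)) = 0 := by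
  have h1 := exch hYx 0 2 [(x, 1)] []
  have h2 := exch hYx 0 1 [] [(x, 2)]
  have h3 := exch hYx 0 1 [(x, 2)] []
  have h4 := exch hYx 0 2 [] [(x, 1)]
  have h5 := exch hxx 1 2 [(Y, 0)] []
  simp only [cs_one, cs_mul, one_mul, List.nil_append, List.cons_append] at h1 h2 h3 h4 h5
  have h := pure6j (cs r) (zv 0) (zv 1) (zv 2) _ _ _ _ _ _ h1 h2 h3 h4 h5
  have hb : BddW (cs r • (word [(x, 1), (x, 2), (Y, 0)] + word [(x, 2), (x, 1), (Y, 0)]) -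
      (cs r * cs r + 1) • (word [(x, 1), (Y, 0), (x, 2)] + word [(x, 2), (Y, 0), (x, 1)]) +
      cs r • (word [(Y, 0), (x, 1), (x, 2)] + word [(Y, 0), (x, 2), (x, 1)])) := by
    refine BddW.word hY _ fun m hm => ?_
    rw [← cs_mul, ← cs_one, ← cs_add]
    simp [wf_sub_apply, wf_add_apply, cs_smul, word_cons, word_nil, hm]
  have hb2 := hb.smul0 r 1 2 (by decide)
  rw [cs_one, one_mul] at hb2
  have g1 := cancel hb2 hr one_ne_zero (i := 1) (by decide) (by rw [cs_one, one_mul]; exact h)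
  have g2 := cancel hb hr one_ne_zero (i := 2) (by decide) (by rw [cs_one, one_mul]; exact g1)
  have := congrFun g2 ![k, m, n, 0]
  rw [← cs_mul, ← cs_one, ← cs_add] at this
  simpa [wf_sub_apply, wf_add_apply, cs_smul, word_cons, word_nil, wf_zero_apply] using this

theorem T6i {r : ℂ} (hr : r ≠ 0) {Y x y : ℤ → A} (hY : Bdd Y) (hYx : Ex (r * r) 1 Y x)
    (hYy : Ex 1 r Y y) (hxy : Ex 1 r x y) (k m n : ℤ) :
    r • (Y k * (x m * y n) + x m * (Y k * y n)) - (r * r + 1) • (Y k * (y n * x m) + x m * (y n * Y k))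
      + r • (y n * (Y k * x m) + y n * (x m * Y k)) = 0 := by
  have h1 := exch hYy 0 2 [(x, 1)] []
  have h2 := exch hYx 0 1 [] [(y, 2)]
  have h3 := exch hYx 0 1 [(y, 2)] []
  have h4 := exch hYy 0 2 [] [(x, 1)]
  have h5 := exch hxy 1 2 [(Y, 0)] []
  simp only [cs_one, cs_mul, one_mul, List.nil_append, List.cons_append] at h1 h2 h3 h4 h5
  have h := pure6i (cs r) (zv 0) (zv 1) (zv 2) _ _ _ _ _ _ h1 h2 h3 h4 h5
  have hb : BddW (cs r • (word [(Y, 0), (x, 1), (y, 2)] + word [(x, 1), (Y, 0), (y, 2)]) -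
      (cs r * cs r + 1) • (word [(Y, 0), (y, 2), (x, 1)] + word [(x, 1), (y, 2), (Y, 0)]) +
      cs r • (word [(y, 2), (Y, 0), (x, 1)] + word [(y, 2), (x, 1), (Y, 0)])) := by
    refine BddW.word hY _ fun m hm => ?_
    rw [← cs_mul, ← cs_one, ← cs_add]
    simp [wf_sub_apply, wf_add_apply, cs_smul, word_cons, word_nil, hm]
  have hb2 := hb.smul0 r 1 2 (by decide)
  rw [cs_one, one_mul] at hb2
  have g1 := cancel hb2 one_ne_zero (mul_ne_zero hr hr) (i := 1) (by decide)
    (by rw [cs_one, one_mul, cs_mul]; exact h)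
  have g2 := cancel hb hr one_ne_zero (i := 2) (by decide) (by rw [cs_one, one_mul]; exact g1)
  have := congrFun g2 ![k, m, n, 0]
  rw [← cs_mul, ← cs_one, ← cs_add] at this
  simpa [wf_sub_apply, wf_add_apply, cs_smul, word_cons, word_nil, wf_zero_apply] using this

end QAS

set_option linter.all false
set_option linter.unusedSectionVars false
set_option linter.unusedSimpArgs false
namespace QAS
variable {A : Type} [Ring A] [Algebra ℂ A]

theorem pure7a {W : Type} [AddCommGroup W] [Module RS W] (p u z1 z2 w : RS)
    (Y1c2 Y2c1 c1Y2 c2Y1 Yc12 w2Y1c w1Y2c Y12c w2c1Y w2cY1 w1c2Y w1cY2 w1Yc2 w2Yc1 : W)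
    (e1 : (p * u - z1) • Yc12 = (u - p * z1) • c1Y2)
    (e2 : (p * u - z2) • (-Yc12) = (u - p * z2) • c2Y1)
    (e3 : (p * u - z2) • (-Y12c) = (u - p * z2) • w2Y1c)
    (e4 : (p * u - z1) • Y12c = (u - p * z1) • w1Y2c)
    (e5 : (p * u - z1) • w2Yc1 = (u - p * z1) • w2c1Y)
    (e6 : (p * u - z2) • w1Yc2 = (u - p * z2) • w1c2Y)
    (e7 : (p * u - z1) • Y1c2 = (u - p * z1) • w1Yc2)
    (e8 : (p * u - z2) • Y2c1 = (u - p * z2) • w2Yc1)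
    (r1 : (z1 - p * w) • Y1c2 = (p * z1 - w) • Yc12)
    (r2 : (z2 - p * w) • Y12c = (p * z2 - w) • Y1c2)
    (r3 : (z2 - p * w) • Y2c1 = (p * z2 - w) • (-Yc12))
    (r4 : (z1 - p * w) • (-Y12c) = (p * z1 - w) • Y2c1) :
    (u - p * z1) • (u - p * z2) •
      (p • (Y1c2 + Y2c1 + c1Y2 + c2Y1 + w2Y1c + w1Y2c + w2c1Y + w1c2Y)
        - (p * p + 1) • (w1Yc2 + w2Yc1)) = 0 := by
  linear_combination (norm := module) (-p * (u - p * z2)) • e1 + (-p * (u - p * z1)) • e2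
    + (-p * (u - p * z1)) • e3 + (-p * (u - p * z2)) • e4
    + (-p * (u - p * z2)) • e5 + (-p * (u - p * z1)) • e6
    + (-(p * (p * u - z2)) + (p * p + 1) * (u - p * z2)) • e7
    + (-(p * (p * u - z1)) + (p * p + 1) * (u - p * z1)) • e8
    + (-((p * p - 1) * u)) • r1 + (-(p * (p * p - 1) * u)) • r2
    + (-((p * p - 1) * u)) • r3 + (-(p * (p * p - 1) * u)) • r4

theorem pure7b {W : Type} [AddCommGroup W] [Module RS W] (p u x z w : RS)
    (aYcb Yacb abcY aYbc Yabc cYab cbaY cYba Ycba baYc Ybac bcYa bacY : W)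
    (e1 : (p * u - x) • Yacb = (u - p * x) • aYcb)
    (e2 : (u - p * w) • aYbc = (p * u - w) • abcY)
    (e3 : (p * u - x) • Yabc = (u - p * x) • aYbc)
    (e4 : (u - p * w) • Yacb = (p * u - w) • cYab)
    (e5 : (p * u - x) • cYba = (u - p * x) • cbaY)
    (e6 : (u - p * w) • Ycba = (p * u - w) • cYba)
    (e7 : (p * u - x) • Ybac = (u - p * x) • baYc)
    (e8 : (u - p * w) • Ybac = (p * u - w) • bcYa)
    (e9 : (u - p * w) • baYc = (p * u - w) • bacY)
    (s1 : (z - p * w) • Yabc = (p * z - w) • Yacb)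
    (s2 : (z - p * w) • Ybac = (p * z - w) • Ycba)
    (s3 : (p * x - z) • Yabc = (x - p * z) • Ybac)
    (s4 : (p * x - z) • Yacb = (x - p * z) • Ycba) :
    (u - p * x) • (p * u - w) •
      (p • (aYcb - abcY + cYab - cbaY - baYc + Yabc - bcYa + Ycba)
        - (p * p + 1) • (Yacb - bacY)) = 0 := by
  linear_combination (norm := module) (-p * (p * u - w)) • e1
    + (p * (u - p * x)) • e2 + (p * (u - p * w)) • e3
    + (-p * (u - p * x)) • e4
    + (p * (p * u - w)) • e5 + (p * (p * u - x)) • e6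
    + (p * (p * u - w) - (p * p + 1) * (u - p * w)) • e7
    + (p * (u - p * x)) • e8
    + (-((p * p + 1) * (u - p * x))) • e9
    + (-((p * p - 1) * u)) • s1 + (p * (p * p - 1) * u) • s2
    + (-((p * p - 1) * u)) • s3 + (p * (p * p - 1) * u) • s4

theorem T7a' {p : ℂ} (hp : p ≠ 0) {Y b c : ℤ → A} (hY : Bdd Y) (hYb : Ex p 1 Y b)
    (hYc : ∀ m n, Y m * c n = c n * Y m) (hbb : ∀ m n, b m * b n = -(b n * b m))
    (hbc : Ex 1 p b c) (m n k s : ℤ) :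
    p • (Y m * (b n * (c k * b s)) + Y m * (b s * (c k * b n)) + c k * (b n * (Y m * b s))
        + c k * (b s * (Y m * b n)) + b s * (Y m * (b n * c k)) + b n * (Y m * (b s * c k))
        + b s * (c k * (b n * Y m)) + b n * (c k * (b s * Y m)))
      - (p * p + 1) • (b n * (Y m * (c k * b s)) + b s * (Y m * (c k * b n))) = 0 := by
  have e1 := exch hYb 0 1 [(c, 3)] [(b, 2)]
  have e2 := exch hYb 0 2 [(c, 3)] [(b, 1)]
  have e3 := exch hYb 0 2 [] [(b, 1), (c, 3)]
  have e4 := exch hYb 0 1 [] [(b, 2), (c, 3)]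
  have e5 := exch hYb 0 1 [(b, 2), (c, 3)] []
  have e6 := exch hYb 0 2 [(b, 1), (c, 3)] []
  have e7 := exch hYb 0 1 [] [(c, 3), (b, 2)]
  have e8 := exch hYb 0 2 [] [(c, 3), (b, 1)]
  have r1 := exch hbc 1 3 [(Y, 0)] [(b, 2)]
  have r2 := exch hbc 2 3 [(Y, 0), (b, 1)] []
  have r3 := exch hbc 2 3 [(Y, 0)] [(b, 1)]
  have r4 := exch hbc 1 3 [(Y, 0), (b, 2)] []
  have c1 := swapC hYc 0 3 [] [(b, 1), (b, 2)]
  have c2 := swapC hYc 0 3 [] [(b, 2), (b, 1)]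
  have c3 := swapC hYc 0 3 [(b, 2)] [(b, 1)]
  have c4 := swapC hYc 0 3 [(b, 1)] [(b, 2)]
  have n1 := swapN hbb 2 1 [(Y, 0), (c, 3)] []
  have n2 := swapN hbb 2 1 [(Y, 0)] [(c, 3)]
  simp only [cs_one, cs_mul, one_mul, List.nil_append, List.cons_append] at e1 e2 e3 e4 e5 e6 e7 e8 r1 r2 r3 r4 c1 c2 c3 c4 n1 n2
  rw [← c1] at e1
  rw [← c2, n1] at e2
  rw [n2] at e3
  rw [← c3] at e5
  rw [← c4] at e6
  rw [n1] at r3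
  rw [n2] at r4
  have h := pure7a (cs p) (zv 0) (zv 1) (zv 2) (zv 3) _ _ _ _ _ _ _ _ _
    (word [(b, 2), (c, 3), (Y, 0), (b, 1)]) _ (word [(b, 1), (c, 3), (Y, 0), (b, 2)]) _ _
    e1 e2 e3 e4 e5 e6 e7 e8 r1 r2 r3 r4
  have hb : BddW (cs p • (word [(Y, 0), (b, 1), (c, 3), (b, 2)] + word [(Y, 0), (b, 2), (c, 3), (b, 1)]
        + word [(c, 3), (b, 1), (Y, 0), (b, 2)] + word [(c, 3), (b, 2), (Y, 0), (b, 1)]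
        + word [(b, 2), (Y, 0), (b, 1), (c, 3)] + word [(b, 1), (Y, 0), (b, 2), (c, 3)]
        + word [(b, 2), (c, 3), (b, 1), (Y, 0)] + word [(b, 1), (c, 3), (b, 2), (Y, 0)]) -
      (cs p * cs p + 1) • (word [(b, 1), (Y, 0), (c, 3), (b, 2)]
        + word [(b, 2), (Y, 0), (c, 3), (b, 1)])) := by
    refine BddW.word hY _ fun m hm => ?_
    rw [← cs_mul, ← cs_one, ← cs_add]
    simp [wf_sub_apply, wf_add_apply, cs_smul, word_cons, word_nil, hm]
  have hb2 := hb.smul0 1 p 2 (by decide)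
  rw [cs_one, one_mul] at hb2
  have g1 := cancel hb2 one_ne_zero hp (i := 1) (by decide)
    (by rw [cs_one, one_mul]; exact h)
  have g2 := cancel hb one_ne_zero hp (i := 2) (by decide) (by rw [cs_one, one_mul]; exact g1)
  have := congrFun g2 ![m, n, s, k]
  rw [← cs_mul, ← cs_one, ← cs_add] at this
  simpa [wf_sub_apply, wf_add_apply, cs_smul, word_cons, word_nil, wf_zero_apply] using this

theorem T7b' {p : ℂ} (hp : p ≠ 0) {Y a b c : ℤ → A} (hY : Bdd Y) (hYa : Ex p 1 Y a)
    (hYb : ∀ m n, Y m * b n = b n * Y m) (hYc : Ex 1 p Y c)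
    (hab : Ex p 1 a b) (hbc : Ex 1 p b c)
    (hac : ∀ m n, a m * c n = c n * a m) (m n k s : ℤ) :
    p • (a m * (Y n * (c k * b s)) - a m * (b s * (c k * Y n)) + c k * (Y n * (a m * b s))
        - c k * (b s * (a m * Y n)) - b s * (a m * (Y n * c k)) + Y n * (a m * (b s * c k))
        - b s * (c k * (Y n * a m)) + Y n * (c k * (b s * a m)))
      - (p * p + 1) • (Y n * (a m * (c k * b s)) - b s * (a m * (c k * Y n))) = 0 := by
  have e1 := exch hYa 0 1 [] [(c, 3), (b, 2)]
  have e2 := exch hYc 0 3 [(a, 1), (b, 2)] []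
  have e3 := exch hYa 0 1 [] [(b, 2), (c, 3)]
  have e4 := exch hYc 0 3 [] [(a, 1), (b, 2)]
  have e5 := exch hYa 0 1 [(c, 3), (b, 2)] []
  have e6 := exch hYc 0 3 [] [(b, 2), (a, 1)]
  have e7 := exch hYa 0 1 [(b, 2)] [(c, 3)]
  have e8 := exch hYc 0 3 [(b, 2)] [(a, 1)]
  have e9 := exch hYc 0 3 [(b, 2), (a, 1)] []
  have s1 := exch hbc 2 3 [(Y, 0), (a, 1)] []
  have s2 := exch hbc 2 3 [(Y, 0)] [(a, 1)]
  have s3 := exch hab 1 2 [(Y, 0)] [(c, 3)]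
  have s4 := exch hab 1 2 [(Y, 0), (c, 3)] []
  have c1 := swapC hYb 0 2 [(a, 1)] [(c, 3)]
  have c2 := swapC hac 1 3 [(Y, 0)] [(b, 2)]
  have c3 := swapC hYb 0 2 [(c, 3)] [(a, 1)]
  have c4 := swapC hYb 0 2 [] [(a, 1), (c, 3)]
  have c5 := swapC hYb 0 2 [] [(c, 3), (a, 1)]
  have c6 := swapC hac 1 3 [(Y, 0), (b, 2)] []
  simp only [cs_one, cs_mul, one_mul, List.nil_append, List.cons_append] at e1 e2 e3 e4 e5 e6 e7 e8 e9 s1 s2 s3 s4 c1 c2 c3 c4 c5 c6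
  rw [← c1] at e2
  rw [← c2] at e4 s4
  rw [← c3] at e5
  rw [← c4] at e7
  rw [← c5, ← c6] at e8
  rw [← c6] at s2
  have h := pure7b (cs p) (zv 0) (zv 1) (zv 2) (zv 3) _ _ _ _ _ _ _ _ _ _ _ _ _
    e1 e2 e3 e4 e5 e6 e7 e8 e9 s1 s2 s3 s4
  have hb : BddW (cs p • (word [(a, 1), (Y, 0), (c, 3), (b, 2)] - word [(a, 1), (b, 2), (c, 3), (Y, 0)]
        + word [(c, 3), (Y, 0), (a, 1), (b, 2)] - word [(c, 3), (b, 2), (a, 1), (Y, 0)]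
        - word [(b, 2), (a, 1), (Y, 0), (c, 3)] + word [(Y, 0), (a, 1), (b, 2), (c, 3)]
        - word [(b, 2), (c, 3), (Y, 0), (a, 1)] + word [(Y, 0), (c, 3), (b, 2), (a, 1)]) -
      (cs p * cs p + 1) • (word [(Y, 0), (a, 1), (c, 3), (b, 2)]
        - word [(b, 2), (a, 1), (c, 3), (Y, 0)])) := by
    refine BddW.word hY _ fun m hm => ?_
    rw [← cs_mul, ← cs_one, ← cs_add]
    simp [wf_sub_apply, wf_add_apply, cs_smul, word_cons, word_nil, hm]
  have hb2 := hb.smul0 p 1 3 (by decide)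
  rw [cs_one, one_mul] at hb2
  have g1 := cancel hb2 one_ne_zero hp (i := 1) (by decide)
    (by rw [cs_one, one_mul]; exact h)
  have g2 := cancel hb hp one_ne_zero (i := 3) (by decide) (by rw [cs_one, one_mul]; exact g1)
  have := congrFun g2 ![n, m, s, k]
  rw [← cs_mul, ← cs_one, ← cs_add] at this
  simpa [wf_sub_apply, wf_add_apply, cs_smul, word_cons, word_nil, wf_zero_apply] using this

end QAS

set_option linter.all false
set_option linter.unusedSectionVars false
set_option linter.unusedSimpArgs false
namespace QAS

section expand
variable {A : Type} [Ring A] [Algebra ℂ A]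

theorem T7a {p q : ℂ} (hp : p ≠ 0) (hpq : p + p⁻¹ = q + q⁻¹) {Y b c : ℤ → A} (hY : Bdd Y) (hYb : Ex 1 p⁻¹ Y b)
    (hYc : ∀ m n, Y m * c n = c n * Y m) (hbb : ∀ m n, b m * b n = -(b n * b m))
    (hbc : Ex 1 p b c) (m n k s : ℤ) :
    (Y m * (b n * (c k * b s)) + Y m * (b s * (c k * b n)) + c k * (b n * (Y m * b s))
        + c k * (b s * (Y m * b n)) + b s * (Y m * (b n * c k)) + b n * (Y m * (b s * c k))
        + b s * (c k * (b n * Y m)) + b n * (c k * (b s * Y m)))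
      - (q + q⁻¹) • (b n * (Y m * (c k * b s)) + b s * (Y m * (c k * b n))) = 0 := by
  have h1 : Ex p 1 Y b := by simpa [hp] using hYb.scale p
  have := congrArg (p⁻¹ • ·) (T7a' hp hY h1 hYc hbb hbc m n k s)
  simp only [smul_sub, smul_zero, smul_smul] at this
  have e : p⁻¹ * (p * p + 1) = q + q⁻¹ := by rw [← hpq]; field_simp
  rw [inv_mul_cancel₀ hp, one_smul, e] at this
  exact this

theorem T7b {p q : ℂ} (hp : p ≠ 0) (hpq : p + p⁻¹ = q + q⁻¹) {Y a b c : ℤ → A} (hY : Bdd Y)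
    (hYa : Ex 1 p⁻¹ Y a)
    (hYb : ∀ m n, Y m * b n = b n * Y m) (hYc : Ex 1 p Y c)
    (hab : Ex 1 p⁻¹ a b) (hbc : Ex 1 p b c)
    (hac : ∀ m n, a m * c n = c n * a m) (m n k s : ℤ) :
    (a m * (Y n * (c k * b s)) - a m * (b s * (c k * Y n)) + c k * (Y n * (a m * b s))
        - c k * (b s * (a m * Y n)) - b s * (a m * (Y n * c k)) + Y n * (a m * (b s * c k))
        - b s * (c k * (Y n * a m)) + Y n * (c k * (b s * a m)))
      - (q + q⁻¹) • (Y n * (a m * (c k * b s)) - b s * (a m * (c k * Y n))) = 0 := by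
  have h1 : Ex p 1 Y a := by simpa [hp] using hYa.scale p
  have h2 : Ex p 1 a b := by simpa [hp] using hab.scale p
  have := congrArg (p⁻¹ • ·) (T7b' hp hY h1 hYb hYc h2 hbc hac m n k s)
  rw [smul_sub, smul_zero, smul_smul, smul_smul] at this
  have e : p⁻¹ * (p * p + 1) = q + q⁻¹ := by rw [← hpq]; field_simp
  rw [inv_mul_cancel₀ hp, one_smul, e] at this
  exact this

theorem T6jq {r q : ℂ} (hr : r ≠ 0) (hrq : r + r⁻¹ = q + q⁻¹) {Y x : ℤ → A} (hY : Bdd Y)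
    (hYx : Ex 1 r Y x) (hxx : Ex 1 (r⁻¹ * r⁻¹) x x) (k m n : ℤ) :
    (x m * (x n * Y k) + x n * (x m * Y k)) - (q + q⁻¹) • (x m * (Y k * x n) + x n * (Y k * x m))
      + (Y k * (x m * x n) + Y k * (x n * x m)) = 0 := by
  have h1 : Ex (r * r) 1 x x := by
    have := hxx.scale (r * r)
    rwa [show r * r * (r⁻¹ * r⁻¹) = 1 by field_simp, mul_one] at this
  have := congrArg (r⁻¹ • ·) (T6j hr hY hYx h1 k m n)
  rw [smul_add, smul_sub, smul_zero, smul_smul, smul_smul, smul_smul] at this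
  have e : r⁻¹ * (r * r + 1) = q + q⁻¹ := by rw [← hrq]; field_simp
  rw [inv_mul_cancel₀ hr, one_smul, one_smul, e] at this
  exact this

theorem T6iq {r q : ℂ} (hr : r ≠ 0) (hrq : r + r⁻¹ = q + q⁻¹) {Y x y : ℤ → A} (hY : Bdd Y)
    (hYx : Ex 1 (r⁻¹ * r⁻¹) Y x)
    (hYy : Ex 1 r Y y) (hxy : Ex 1 r x y) (k m n : ℤ) :
    (Y k * (x m * y n) + x m * (Y k * y n)) - (q + q⁻¹) • (Y k * (y n * x m) + x m * (y n * Y k))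
      + (y n * (Y k * x m) + y n * (x m * Y k)) = 0 := by
  have h1 : Ex (r * r) 1 Y x := by
    have := hYx.scale (r * r)
    rwa [show r * r * (r⁻¹ * r⁻¹) = 1 by field_simp, mul_one] at this
  have := congrArg (r⁻¹ • ·) (T6i hr hY h1 hYy hxy k m n)
  rw [smul_add, smul_sub, smul_zero, smul_smul, smul_smul, smul_smul] at this
  have e : r⁻¹ * (r * r + 1) = q + q⁻¹ := by rw [← hrq]; field_simp
  rw [inv_mul_cancel₀ hr, one_smul, one_smul, e] at this
  exact this

theorem map_brF {B : Type} [Ring B] [Algebra ℂ B] (f : A →ₐ[ℂ] B) (u : ℂ) (x y : A) :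
    f (brF u x y) = brF u (f x) (f y) := by
  simp [brF]

theorem serre_expand {q : ℂ} (hq : q ≠ 0) (x1 x2 y : A) :
    brF q x1 (brF q⁻¹ x2 y) + brF q x2 (brF q⁻¹ x1 y) =
      x1 * (x2 * y) + x2 * (x1 * y) - (q + q⁻¹) • (x1 * (y * x2) + x2 * (y * x1))
      + (y * (x2 * x1) + y * (x1 * x2)) := by
  simp only [brF, mul_sub, sub_mul, smul_sub, mul_smul_comm, smul_mul_assoc, smul_smul,
    mul_inv_cancel₀ hq, mul_assoc]
  module

theorem osc_expand {q : ℂ} (hq : q ≠ 0) (a b c d : A) :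
    brF q (brF q⁻¹ a b) c * d + d * brF q (brF q⁻¹ a b) c =
      a * (b * (c * d)) - q⁻¹ • (b * (a * (c * d))) - q • (c * (a * (b * d)))
      + c * (b * (a * d)) + d * (a * (b * c)) - q⁻¹ • (d * (b * (a * c)))
      - q • (d * (c * (a * b))) + d * (c * (b * a)) := by
  simp only [brF, mul_sub, sub_mul, smul_sub, mul_smul_comm, smul_mul_assoc, smul_smul,
    mul_inv_cancel₀ hq, mul_assoc]
  module

end expand

section cartan
theorem cc_symm (M i j : ℕ) : cc M i j = cc M j i := by
  rcases lt_trichotomy i j with h | rfl | h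
  · by_cases h' : i + 1 = j
    · subst h'
      have a1 : i ≠ i + 1 + 1 := by omega
      simp [cc, form4, innerE, a1, a1.symm]
    · have e1 : i ≠ j := by omega
      have e2 : i ≠ j + 1 := by omega
      simp [cc, form4, innerE, e1, e2, h', e1.symm, e2.symm, Ne.symm h']
  · rfl
  · by_cases h' : j + 1 = i
    · subst h'
      have a1 : j ≠ j + 1 + 1 := by omega
      simp [cc, form4, innerE, a1, a1.symm]
    · have e1 : i ≠ j := by omega
      have e2 : j ≠ i + 1 := by omega
      simp [cc, form4, innerE, e1, e2, h', e1.symm, e2.symm, Ne.symm h']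

theorem cc_self (M i : ℕ) : cc M i i = lof M i + lof M (i + 1) := by
  simp [cc, form4, innerE]

theorem cc_succ (M i : ℕ) : cc M i (i + 1) = - lof M (i + 1) := by
  have a1 : i ≠ i + 1 + 1 := by omega
  simp [cc, form4, innerE, a1, a1.symm]

theorem cc_far (M i j : ℕ) (h1 : i ≠ j) (h2 : i + 1 ≠ j) (h3 : j + 1 ≠ i) : cc M i j = 0 := by
  have h4 : i ≠ j + 1 := h3.symm
  simp [cc, form4, innerE, h1, h2, h4]

theorem cc_serre {M i j : ℕ} (h : cc M i j = 1 ∨ cc M i j = -1) (hi : i ≠ M) :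
    cc M i i = -2 * cc M i j ∧ i ≠ j := by
  have hs := cc_self M i
  have l1 : lof M i = lof M (i + 1) := by unfold lof; split_ifs <;> omega
  have l2 : lof M i = 1 ∨ lof M i = -1 := by unfold lof; split_ifs <;> simp
  by_cases h1 : i = j
  · subst h1; omega
  by_cases h2 : i + 1 = j
  · subst h2
    have := cc_succ M i
    omega
  by_cases h3 : j + 1 = i
  · subst h3
    have := cc_succ M j
    rw [cc_symm] at this
    omega
  · have := cc_far M i j h1 h2 h3
    omega

theorem cc_self_ne {M i : ℕ} (h : cc M i i ≠ 0) : i ≠ M := by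
  rintro rfl
  apply h
  unfold cc form4 innerE lof
  split_ifs <;> omega

theorem cc_MM (M : ℕ) : cc M M M = 0 := by
  unfold cc form4 innerE lof
  split_ifs <;> omega

theorem cc_ab {M : ℕ} (hM : 1 < M) : cc M (M - 1) M = -1 := by
  unfold cc form4 innerE lof
  split_ifs <;> omega

theorem cc_bc {M : ℕ} : cc M M (M + 1) = 1 := by
  unfold cc form4 innerE lof
  split_ifs <;> omega

theorem cc_ac {M : ℕ} (hM : 1 < M) : cc M (M - 1) (M + 1) = 0 := by
  unfold cc form4 innerE lof
  split_ifs <;> omega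

/-- signed Cartan pairing. -/
abbrev ce (M : ℕ) (pl : Bool) (i j : ℕ) : ℤ := if pl then cc M i j else -cc M i j
end cartan

end QAS

set_option linter.all false
set_option linter.unusedSectionVars false
set_option linter.unusedSimpArgs false
namespace QAS

section tw
variable {A : Type} [Ring A] [Algebra ℂ A] {G : Type}

/-- the upper triangular homomorphism. -/
def utH (l y r : G → A) : FreeAlgebra ℂ G →ₐ[ℂ] Matrix (Fin 2) (Fin 2) A :=
  FreeAlgebra.lift ℂ (fun g => !![l g, y g; 0, r g])

/-- twisted derivation of a free algebra. -/
def tw (l y r : G → A) : FreeAlgebra ℂ G →ₗ[ℂ] A where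
  toFun w := utH l y r w 0 1
  map_add' a b := by simp
  map_smul' c a := by simp

theorem utH_entries (l y r : G → A) (w : FreeAlgebra ℂ G) :
    utH l y r w 0 0 = FreeAlgebra.lift ℂ l w ∧ utH l y r w 1 0 = 0 ∧
      utH l y r w 1 1 = FreeAlgebra.lift ℂ r w := by
  induction w using FreeAlgebra.induction with
  | grade0 c => simp [utH, Matrix.algebraMap_matrix_apply]
  | grade1 g => simp [utH]
  | mul a b ha hb =>
    simp only [map_mul, Matrix.mul_apply, Fin.sum_univ_two]
    obtain ⟨h1, h2, h3⟩ := ha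
    obtain ⟨k1, k2, k3⟩ := hb
    simp [h1, h2, h3, k1, k2, k3]
  | add a b ha hb =>
    obtain ⟨h1, h2, h3⟩ := ha
    obtain ⟨k1, k2, k3⟩ := hb
    simp [h1, h2, h3, k1, k2, k3]

theorem tw_ι (l y r : G → A) (g : G) : tw l y r (FreeAlgebra.ι ℂ g) = y g := by
  simp [tw, utH]

theorem tw_mul (l y r : G → A) (a b : FreeAlgebra ℂ G) :
    tw l y r (a * b) = FreeAlgebra.lift ℂ l a * tw l y r b + tw l y r a * FreeAlgebra.lift ℂ r b := by
  obtain ⟨h1, h2, h3⟩ := utH_entries l y r a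
  obtain ⟨k1, k2, k3⟩ := utH_entries l y r b
  simp [tw, Matrix.mul_apply, h1, h2, h3, k1, k2, k3]

theorem tw_algebraMap (l y r : G → A) (c : ℂ) : tw l y r (algebraMap ℂ _ c) = 0 := by
  simp [tw, utH, Matrix.algebraMap_matrix_apply]

theorem tw_one (l y r : G → A) : tw l y r 1 = 0 := by
  simpa using tw_algebraMap l y r 1

theorem tw_add (l y y' r : G → A) (w : FreeAlgebra ℂ G) :
    tw l (fun g => y g + y' g) r w = tw l y r w + tw l y' r w := by
  induction w using FreeAlgebra.induction with
  | grade0 c => simp [tw_algebraMap]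
  | grade1 g => simp [tw_ι]
  | mul a b ha hb => rw [tw_mul, tw_mul, tw_mul, ha, hb]; noncomm_ring
  | add a b ha hb => rw [map_add, map_add, map_add, ha, hb]; abel

/-- inner twisted derivations. -/
theorem tw_inner (l r : G → A) (Z : A) (w : FreeAlgebra ℂ G) :
    tw l (fun g => Z * r g - l g * Z) r w =
      Z * FreeAlgebra.lift ℂ r w - FreeAlgebra.lift ℂ l w * Z := by
  induction w using FreeAlgebra.induction with
  | grade0 c => rw [tw_algebraMap]; simp [Algebra.commutes]
  | grade1 g => simp [tw_ι]
  | mul a b ha hb => rw [tw_mul, ha, hb]; simp only [map_mul]; noncomm_ring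
  | add a b ha hb => rw [map_add, ha, hb]; simp only [map_add]; noncomm_ring

theorem tw_eq_utH {l y r : G → A} {a b : FreeAlgebra ℂ G}
    (h1 : FreeAlgebra.lift ℂ l a = FreeAlgebra.lift ℂ l b)
    (h2 : FreeAlgebra.lift ℂ r a = FreeAlgebra.lift ℂ r b)
    (h3 : tw l y r a = tw l y r b) : utH l y r a = utH l y r b := by
  obtain ⟨a1, a2, a3⟩ := utH_entries l y r a
  obtain ⟨b1, b2, b3⟩ := utH_entries l y r b
  ext i j
  fin_cases i <;> fin_cases j
  · simpa [a1, b1] using h1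
  · exact h3
  · simp [a2, b2]
  · simpa [a3, b3] using h2

end tw

section fam
variable {A : Type} [Ring A] [Algebra ℂ A] {M N : ℕ}

/-- uncurrying a family of currents. -/
def un (x : Idx M N → ℤ → A) : Idx M N × ℤ → A := fun g => x g.1 g.2

/-- evaluation of noncommutative polynomials. -/
abbrev ev (x : Idx M N → ℤ → A) : FreeAlgebra ℂ (Idx M N × ℤ) →ₐ[ℂ] A :=
  FreeAlgebra.lift ℂ (un x)

theorem ev_ι (x : Idx M N → ℤ → A) (i : Idx M N) (m : ℤ) :
    FreeAlgebra.lift ℂ (un x) (FreeAlgebra.ι ℂ ((i, m) : Idx M N × ℤ)) = x i m := by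
  simp [un]

/-- the family satisfies all one-sided relations. -/
def Sat (q : ℂ) (M N : ℕ) (pl : Bool) (x : Idx M N → ℤ → A) : Prop :=
  ∀ a b, rel1 q M N pl a b → ev x a = ev x b

/-- the quadratic relations only. -/
structure Q45 (q : ℂ) (M N : ℕ) (pl : Bool) (x : Idx M N → ℤ → A) : Prop where
  c0 : ∀ (i j : Idx M N), cc M i.1 j.1 = 0 → ∀ m n, x i m * x j n = sgn M i.1 j.1 • (x j n * x i m)
  c1 : ∀ (i j : Idx M N), cc M i.1 j.1 ≠ 0 → Ex 1 (q ^ ce M pl i.1 j.1) (x i) (x j)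

theorem XgF_eq (i : Idx M N) (n : ℤ) : XgF M N i.1 n = FreeAlgebra.ι ℂ ((i, n) : Idx M N × ℤ) := by
  unfold XgF; rw [dif_pos i.2]

/-- index triples around the odd node. -/
structure Tri (M N : ℕ) where
  a : Idx M N
  b : Idx M N
  c : Idx M N
  ha : a.1 + 1 = M
  hb : b.1 = M
  hc : c.1 = M + 1

def mkTri (hM : 1 < M) (hN : 1 < N) : Tri M N where
  a := ⟨M - 1, by omega, by omega⟩
  b := ⟨M, by omega, by omega⟩
  c := ⟨M + 1, by omega, by omega⟩
  ha := by simp; omega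
  hb := rfl
  hc := rfl

/-- expanded oscillation expression. -/
def oscX (q : ℂ) (a b c d : A) : A :=
  a * (b * (c * d)) - q⁻¹ • (b * (a * (c * d))) - q • (c * (a * (b * d)))
      + c * (b * (a * d)) + d * (a * (b * c)) - q⁻¹ • (d * (b * (a * c)))
      - q • (d * (c * (a * b))) + d * (c * (b * a))

def serX (q : ℂ) (x1 x2 y : A) : A :=
  x1 * (x2 * y) + x2 * (x1 * y) - (q + q⁻¹) • (x1 * (y * x2) + x2 * (y * x1))
      + (y * (x2 * x1) + y * (x1 * x2))

/-- expanded version of the relations, as an eliminator. -/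
theorem rel1_cases {q : ℂ} (hq : q ≠ 0) {pl : Bool}
    {P : FreeAlgebra ℂ (Idx M N × ℤ) → FreeAlgebra ℂ (Idx M N × ℤ) → Prop}
    (h0 : ∀ (i j : Idx M N) (m n : ℤ) (h : cc M i.1 j.1 = 0), P
        (FreeAlgebra.ι ℂ ((i, m) : Idx M N × ℤ) * FreeAlgebra.ι ℂ ((j, n) : Idx M N × ℤ) -
          sgn M i.1 j.1 •
            (FreeAlgebra.ι ℂ ((j, n) : Idx M N × ℤ) * FreeAlgebra.ι ℂ ((i, m) : Idx M N × ℤ))) 0)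
    (h2 : ∀ (i j : Idx M N) (m n : ℤ) (h : cc M i.1 j.1 ≠ 0), P
        (FreeAlgebra.ι ℂ ((i, m + 1) : Idx M N × ℤ) * FreeAlgebra.ι ℂ ((j, n) : Idx M N × ℤ) -
          (q ^ (ce M pl i.1 j.1)) •
            (FreeAlgebra.ι ℂ ((j, n) : Idx M N × ℤ) *
              FreeAlgebra.ι ℂ ((i, m + 1) : Idx M N × ℤ)))
        ((q ^ (ce M pl i.1 j.1)) •
            (FreeAlgebra.ι ℂ ((i, m) : Idx M N × ℤ) *
              FreeAlgebra.ι ℂ ((j, n + 1) : Idx M N × ℤ)) -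
          FreeAlgebra.ι ℂ ((j, n + 1) : Idx M N × ℤ) * FreeAlgebra.ι ℂ ((i, m) : Idx M N × ℤ)))
    (hs : ∀ (i j : Idx M N) (m n k : ℤ) (h : cc M i.1 j.1 = 1 ∨ cc M i.1 j.1 = -1)
      (hi : i.1 ≠ M), P (serX q (FreeAlgebra.ι ℂ ((i, m) : Idx M N × ℤ))
        (FreeAlgebra.ι ℂ ((i, n) : Idx M N × ℤ)) (FreeAlgebra.ι ℂ ((j, k) : Idx M N × ℤ))) 0)
    (ho : ∀ (T : Tri M N) (m n k u : ℤ), P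
      (oscX q (FreeAlgebra.ι ℂ ((T.a, m) : Idx M N × ℤ)) (FreeAlgebra.ι ℂ ((T.b, n) : Idx M N × ℤ))
        (FreeAlgebra.ι ℂ ((T.c, k) : Idx M N × ℤ)) (FreeAlgebra.ι ℂ ((T.b, u) : Idx M N × ℤ)) +
      oscX q (FreeAlgebra.ι ℂ ((T.a, m) : Idx M N × ℤ)) (FreeAlgebra.ι ℂ ((T.b, u) : Idx M N × ℤ))
        (FreeAlgebra.ι ℂ ((T.c, k) : Idx M N × ℤ)) (FreeAlgebra.ι ℂ ((T.b, n) : Idx M N × ℤ))) 0)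
    {a b} (h : rel1 q M N pl a b) : P a b := by
  cases h with
  | comm0 i j m n h => exact h0 i j m n h
  | deg2 i j m n h => exact h2 i j m n h
  | serre i j m n k h hi =>
    rw [serre_expand hq]
    exact hs i j m n k h hi
  | osc m n k u hM hN =>
    let T : Tri M N := mkTri hM hN
    have ea : ∀ n, XgF M N (M - 1) n = FreeAlgebra.ι ℂ ((T.a, n) : Idx M N × ℤ) := XgF_eq T.a
    have eb : ∀ n, XgF M N M n = FreeAlgebra.ι ℂ ((T.b, n) : Idx M N × ℤ) := XgF_eq T.b
    have ec : ∀ n, XgF M N (M + 1) n = FreeAlgebra.ι ℂ ((T.c, n) : Idx M N × ℤ) := XgF_eq T.c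
    simp only [oscOf, ea, eb, ec, osc_expand hq]
    exact ho T m n k u

/-- converse: expanded relations are relations. -/
theorem rel1_osc {q : ℂ} (hq : q ≠ 0) (pl : Bool) (T : Tri M N) (m n k u : ℤ) : rel1 q M N pl
      (oscX q (FreeAlgebra.ι ℂ ((T.a, m) : Idx M N × ℤ)) (FreeAlgebra.ι ℂ ((T.b, n) : Idx M N × ℤ))
        (FreeAlgebra.ι ℂ ((T.c, k) : Idx M N × ℤ)) (FreeAlgebra.ι ℂ ((T.b, u) : Idx M N × ℤ)) +
      oscX q (FreeAlgebra.ι ℂ ((T.a, m) : Idx M N × ℤ)) (FreeAlgebra.ι ℂ ((T.b, u) : Idx M N × ℤ))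
        (FreeAlgebra.ι ℂ ((T.c, k) : Idx M N × ℤ)) (FreeAlgebra.ι ℂ ((T.b, n) : Idx M N × ℤ))) 0 := by
  have h1 := T.a.2
  have h2 := T.c.2
  have h3 := T.ha
  have h4 := T.hc
  have hM : 1 < M := by omega
  have hN : 1 < N := by omega
  have ea : ∀ n, XgF M N (M - 1) n = FreeAlgebra.ι ℂ ((T.a, n) : Idx M N × ℤ) := by
    intro n; rw [← XgF_eq, show M - 1 = T.a.1 by omega]
  have eb : ∀ n, XgF M N M n = FreeAlgebra.ι ℂ ((T.b, n) : Idx M N × ℤ) := by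
    intro n; rw [← XgF_eq, T.hb]
  have ec : ∀ n, XgF M N (M + 1) n = FreeAlgebra.ι ℂ ((T.c, n) : Idx M N × ℤ) := by
    intro n; rw [← XgF_eq, T.hc]
  have := rel1.osc (q := q) (pl := pl) m n k u hM hN
  simp only [oscOf, ea, eb, ec, osc_expand hq] at this
  exact this

theorem rel1_serre {q : ℂ} (hq : q ≠ 0) (pl : Bool) (i j : Idx M N) (m n k : ℤ)
    (h : cc M i.1 j.1 = 1 ∨ cc M i.1 j.1 = -1) (hi : i.1 ≠ M) : rel1 q M N pl
      (serX q (FreeAlgebra.ι ℂ ((i, m) : Idx M N × ℤ))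
        (FreeAlgebra.ι ℂ ((i, n) : Idx M N × ℤ)) (FreeAlgebra.ι ℂ ((j, k) : Idx M N × ℤ))) 0 := by
  have := rel1.serre (q := q) (pl := pl) i j m n k h hi
  rw [serre_expand hq] at this
  exact this

theorem Sat.q45 {q : ℂ} {pl : Bool} {x : Idx M N → ℤ → A} (h : Sat q M N pl x) : Q45 q M N pl x where
  c0 i j hc m n := by
    have := h _ _ (rel1.comm0 i j m n hc)
    simpa [un, sub_eq_zero] using this
  c1 i j hc m n := by
    have := h _ _ (rel1.deg2 i j m n hc)
    simp only [map_sub, map_mul, map_smul, ev_ι] at this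
    simp only [one_smul]
    exact this

/-- homogeneity of the relations. -/
theorem rel1_homog {q : ℂ} (hq : q ≠ 0) {pl : Bool} (f : Idx M N → ℂ) (hf : ∀ i, f i ≠ 0) {a b}
    (h : rel1 q M N pl a b) : ∃ s : ℂ, s ≠ 0 ∧ ∀ (A : Type) [Ring A] [Algebra ℂ A]
      (x : Idx M N → ℤ → A), ev (fun i m => f i • x i m) (a - b) = s • ev x (a - b) := by
  revert h
  apply rel1_cases hq
    (P := fun a b => ∃ s : ℂ, s ≠ 0 ∧ ∀ (A : Type) [Ring A] [Algebra ℂ A]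
      (x : Idx M N → ℤ → A), ev (fun i m => f i • x i m) (a - b) = s • ev x (a - b))
  · intro i j m n h
    refine ⟨f i * f j, mul_ne_zero (hf i) (hf j), fun A _ _ x => ?_⟩
    simp only [map_sub, map_mul, map_smul, map_zero, ev_ι, smul_mul_assoc, mul_smul_comm, smul_smul]
    module
  · intro i j m n h
    refine ⟨f i * f j, mul_ne_zero (hf i) (hf j), fun A _ _ x => ?_⟩
    simp only [map_sub, map_mul, map_smul, map_zero, ev_ι, smul_mul_assoc, mul_smul_comm, smul_smul]
    module
  · intro i j m n k h hi
    refine ⟨f i * f i * f j, mul_ne_zero (mul_ne_zero (hf i) (hf i)) (hf j), fun A _ _ x => ?_⟩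
    simp only [serX, map_add, map_sub, map_mul, map_smul, map_zero, ev_ι, smul_mul_assoc, mul_smul_comm, smul_smul]
    module
  · intro T m n k u
    refine ⟨f T.a * f T.b * f T.c * f T.b, by simp [hf], fun A _ _ x => ?_⟩
    simp only [oscX, map_add, map_sub, map_mul, map_smul, map_zero, ev_ι, smul_mul_assoc, mul_smul_comm, smul_smul]
    module

theorem Sat.scale {q : ℂ} (hq : q ≠ 0) {pl : Bool} {x : Idx M N → ℤ → A} (h : Sat q M N pl x)
    (f : Idx M N → ℂ) (hf : ∀ i, f i ≠ 0) : Sat q M N pl (fun i m => f i • x i m) := by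
  intro a b hab
  obtain ⟨s, hs, e⟩ := rel1_homog hq f hf hab
  have e1 := e A x
  rw [map_sub, map_sub, h a b hab, sub_self, smul_zero, sub_eq_zero] at e1
  exact e1

/-- shift derivations respect the relations. -/
theorem Sat.shift {q : ℂ} (hq : q ≠ 0) {pl : Bool} {x : Idx M N → ℤ → A} (h : Sat q M N pl x)
    (d : Idx M N → ℂ) (s : ℤ) {a b} (hab : rel1 q M N pl a b) :
    tw (un x) (fun g => d g.1 • x g.1 (g.2 + s)) (un x) a =
    tw (un x) (fun g => d g.1 • x g.1 (g.2 + s)) (un x) b := by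
  revert hab
  apply rel1_cases hq (P := fun a b => tw (un x) (fun g => d g.1 • x g.1 (g.2 + s)) (un x) a =
    tw (un x) (fun g => d g.1 • x g.1 (g.2 + s)) (un x) b)
  · intro i j m n hc
    have h1 := h.q45.c0 i j hc (m + s) n
    have h2 := h.q45.c0 i j hc m (n + s)
    simp only [map_sub, map_smul, map_zero, tw_mul, tw_ι, ev_ι, smul_mul_assoc, mul_smul_comm]
    linear_combination (norm := module) d i • h1 + d j • h2
  · intro i j m n hc
    have h1 := h.q45.c1 i j hc (m + s) n
    have h2 := h.q45.c1 i j hc m (n + s)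
    simp only [map_sub, map_smul, map_zero, tw_mul, tw_ι, ev_ι, smul_mul_assoc, mul_smul_comm]
    rw [show m + s + 1 = m + 1 + s by ring] at h1
    rw [show n + s + 1 = n + 1 + s by ring] at h2
    linear_combination (norm := module) d i • h1 + d j • h2
  · intro i j m n k hc hi
    have h1 := h _ _ (rel1_serre hq pl i j (m + s) n k hc hi)
    have h2 := h _ _ (rel1_serre hq pl i j m (n + s) k hc hi)
    have h3 := h _ _ (rel1_serre hq pl i j m n (k + s) hc hi)
    simp only [serX, map_add, map_sub, map_smul, map_mul, map_zero, tw_mul, tw_ι, ev_ι, smul_mul_assoc, mul_smul_comm, mul_add, add_mul] at h1 h2 h3 ⊢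
    linear_combination (norm := module) d i • h1 + d i • h2 + d j • h3
  · intro T m n k u
    have h1 := h _ _ (rel1_osc hq pl T (m + s) n k u)
    have h2 := h _ _ (rel1_osc hq pl T m (n + s) k u)
    have h3 := h _ _ (rel1_osc hq pl T m n (k + s) u)
    have h4 := h _ _ (rel1_osc hq pl T m n k (u + s))
    simp only [oscX, map_add, map_sub, map_smul, map_mul, map_zero, tw_mul, tw_ι, ev_ι, smul_mul_assoc, mul_smul_comm, mul_add, add_mul] at h1 h2 h3 h4 ⊢
    linear_combination (norm := module) d T.a • h1 + d T.b • h2 + d T.c • h3 + d T.b • h4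

end fam
end QAS

set_option linter.all false
set_option linter.unusedSectionVars false
set_option linter.unusedSimpArgs false
namespace QAS

section hat
variable {A : Type} [Ring A] [Algebra ℂ A] {M N : ℕ}

theorem sgn_symm (M i j : ℕ) : sgn M i j = sgn M j i := by
  unfold sgn; simp only [and_comm]

theorem sgn_sq (M i j : ℕ) : sgn M i j * sgn M i j = 1 := by
  unfold sgn; split_ifs <;> norm_num

theorem sgn_ne (M i j : ℕ) : sgn M i j ≠ 0 := by
  unfold sgn; split_ifs <;> norm_num

theorem sgn_of_ne {M i j : ℕ} (h : i ≠ M ∨ j ≠ M) : sgn M i j = 1 := by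
  unfold sgn; rw [if_neg]; omega

theorem sgn_of_cc {M i j : ℕ} (h : cc M i j ≠ 0) : sgn M i j = 1 := by
  unfold sgn; rw [if_neg]; rintro ⟨rfl, rfl⟩; exact h (cc_MM _)

theorem sgn_MM (M : ℕ) : sgn M M M = -1 := by simp [sgn]

theorem ce_symm (M : ℕ) (pl : Bool) (i j : ℕ) : ce M pl i j = ce M pl j i := by
  unfold ce; rw [cc_symm]

/-- bounded currents with the right exchange relations. -/
def GoodB (q : ℂ) (pl : Bool) (x : Idx M N → ℤ → A) (k : Idx M N) (Y : ℤ → A) : Prop :=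
  Bdd Y ∧ ∀ j, Ex 1 (q ^ ce M pl k.1 j.1) Y (x j)

def Good (q : ℂ) (pl : Bool) (x : Idx M N → ℤ → A) (k : Idx M N) (Y : ℤ → A) : Prop :=
  ∃ Y1 Y2, GoodB q pl x k Y1 ∧ GoodB q pl x k Y2 ∧ ∀ n, Y n = Y1 n + Y2 n

theorem GoodB.comm {q : ℂ} {pl : Bool} {x : Idx M N → ℤ → A} {k : Idx M N} {Y : ℤ → A}
    (h : GoodB q pl x k Y) {j : Idx M N} (hc : cc M k.1 j.1 = 0) (m n : ℤ) :
    Y m * x j n = x j n * Y m := by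
  apply comm_of_Ex h.1
  have := h.2 j
  simpa [ce, hc] using this

theorem GoodB.affine {q : ℂ} {pl : Bool} {x : Idx M N → ℤ → A} {k : Idx M N} {Y : ℤ → A}
    (h : GoodB q pl x k Y) (c : ℂ) (s : ℤ) : GoodB q pl x k (fun n => c • Y (n + s)) := by
  refine ⟨?_, ?_⟩
  · obtain ⟨B, hB⟩ := h.1
    refine ⟨B - s, ?_⟩
    rcases hB with hB | hB
    · left; intro n hn; show c • Y (n + s) = 0; rw [hB _ (by omega), smul_zero]
    · right; intro n hn; show c • Y (n + s) = 0; rw [hB _ (by omega), smul_zero]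
  · intro j m n
    have := h.2 j (m + s) n
    simp only [smul_mul_assoc, mul_smul_comm]
    rw [show m + 1 + s = m + s + 1 by ring]
    linear_combination (norm := module) c • this

theorem Good.affine {q : ℂ} {pl : Bool} {x : Idx M N → ℤ → A} {k : Idx M N} {Y : ℤ → A}
    (h : Good q pl x k Y) (c : ℂ) (s : ℤ) : Good q pl x k (fun n => c • Y (n + s)) := by
  obtain ⟨Y1, Y2, h1, h2, e⟩ := h
  exact ⟨_, _, h1.affine c s, h2.affine c s, fun n => by simp only [e, smul_add]⟩

/-- the off-diagonal part of the hat family. -/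
def hy (k : Idx M N) (Y : ℤ → A) : Idx M N × ℤ → A := fun g => if g.1 = k then Y g.2 else 0

/-- the twisted family. -/
def hl (k : Idx M N) (x : Idx M N → ℤ → A) : Idx M N → ℤ → A := fun i m => sgn M k.1 i.1 • x i m

def hatD (x : Idx M N → ℤ → A) (k : Idx M N) (Y : ℤ → A) : FreeAlgebra ℂ (Idx M N × ℤ) →ₗ[ℂ] A :=
  tw (un (hl k x)) (hy k Y) (un x)

theorem hatD_mul (x : Idx M N → ℤ → A) (k : Idx M N) (Y : ℤ → A) (a b) :
    hatD x k Y (a * b) = ev (hl k x) a * hatD x k Y b + hatD x k Y a * ev x b := tw_mul _ _ _ _ _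

theorem hatD_same (x : Idx M N → ℤ → A) (k : Idx M N) (Y : ℤ → A) (m : ℤ) :
    hatD x k Y (FreeAlgebra.ι ℂ ((k, m) : Idx M N × ℤ)) = Y m := by
  simp [hatD, tw_ι, hy]

theorem hatD_ne (x : Idx M N → ℤ → A) {k i : Idx M N} (h : i ≠ k) (Y : ℤ → A) (m : ℤ) :
    hatD x k Y (FreeAlgebra.ι ℂ ((i, m) : Idx M N × ℤ)) = 0 := by
  simp [hatD, tw_ι, hy, h]

theorem hl_ι (x : Idx M N → ℤ → A) (k : Idx M N) (i : Idx M N) (m : ℤ) :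
    FreeAlgebra.lift ℂ (un (hl k x)) (FreeAlgebra.ι ℂ ((i, m) : Idx M N × ℤ))
      = sgn M k.1 i.1 • x i m := by
  simp [un, hl]

variable {q : ℂ} {pl : Bool} {x : Idx M N → ℤ → A} {k : Idx M N} {Y : ℤ → A}

theorem hatB_comm0 (h : GoodB q pl x k Y) (i j : Idx M N) (m n : ℤ) (hc : cc M i.1 j.1 = 0) :
    hatD x k Y (FreeAlgebra.ι ℂ ((i, m) : Idx M N × ℤ) * FreeAlgebra.ι ℂ ((j, n) : Idx M N × ℤ) -
          sgn M i.1 j.1 •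
            (FreeAlgebra.ι ℂ ((j, n) : Idx M N × ℤ) * FreeAlgebra.ι ℂ ((i, m) : Idx M N × ℤ))) = 0 := by
  simp only [map_sub, map_smul, hatD_mul, ev_ι, hl]
  by_cases hi : i = k
  · subst hi
    have s1 := sgn_sq M i.1 j.1
    by_cases hj : j = i
    · subst hj
      have c1 := h.comm hc m n
      have c2 := h.comm hc n m
      simp only [hatD_same, smul_mul_assoc, mul_smul_comm, smul_smul, smul_add, s1]
      rw [c1, c2]
      module
    · have c1 := h.comm hc m n
      simp only [hatD_same, hatD_ne x hj, smul_mul_assoc, mul_smul_comm, smul_smul, smul_add, s1, mul_zero,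
        zero_mul, smul_zero]
      rw [c1]
      module
  · by_cases hj : j = k
    · subst hj
      have c1 := h.comm (by rwa [cc_symm]) n m
      simp only [hatD_same, hatD_ne x hi, smul_mul_assoc, mul_smul_comm, smul_smul, smul_add, mul_zero,
        zero_mul, smul_zero, sgn_symm M j.1 i.1]
      rw [c1]
      module
    · simp [hatD_ne x hi, hatD_ne x hj]

theorem hatB_deg2 (h : GoodB q pl x k Y) (i j : Idx M N) (m n : ℤ) (hc : cc M i.1 j.1 ≠ 0) :
    hatD x k Y
        (FreeAlgebra.ι ℂ ((i, m + 1) : Idx M N × ℤ) * FreeAlgebra.ι ℂ ((j, n) : Idx M N × ℤ) -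
          (q ^ (ce M pl i.1 j.1)) •
            (FreeAlgebra.ι ℂ ((j, n) : Idx M N × ℤ) *
              FreeAlgebra.ι ℂ ((i, m + 1) : Idx M N × ℤ)))
    = hatD x k Y ((q ^ (ce M pl i.1 j.1)) •
            (FreeAlgebra.ι ℂ ((i, m) : Idx M N × ℤ) *
              FreeAlgebra.ι ℂ ((j, n + 1) : Idx M N × ℤ)) -
          FreeAlgebra.ι ℂ ((j, n + 1) : Idx M N × ℤ) * FreeAlgebra.ι ℂ ((i, m) : Idx M N × ℤ)) := by
  simp only [map_sub, map_smul, hatD_mul, ev_ι, hl]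
  by_cases hi : i = k
  · subst hi
    have s1 := sgn_of_cc hc
    have c1 := h.2 j m n
    by_cases hj : j = i
    · subst hj
      have c2 := (h.2 j).symm m n
      simp only [hatD_same, s1, one_smul] at c1 c2 ⊢
      linear_combination (norm := module) c1 + c2
    · simp only [hatD_same, hatD_ne x hj, s1, one_smul, mul_zero, zero_mul, add_zero, zero_add] at c1 ⊢
      linear_combination (norm := module) c1
  · by_cases hj : j = k
    · subst hj
      have s1 := sgn_of_cc (M := M) (i := j.1) (j := i.1) (by rwa [cc_symm])
      have c1 := (h.2 i).symm m n
      rw [ce_symm] at c1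
      simp only [hatD_same, hatD_ne x hi, s1, one_smul, mul_zero, zero_mul, add_zero, zero_add] at c1 ⊢
      linear_combination (norm := module) c1
    · simp [hatD_ne x hi, hatD_ne x hj]

theorem qr {q : ℂ} (hq : q ≠ 0) {e : ℤ} (h : e = 1 ∨ e = -1) :
    q ^ e ≠ 0 ∧ q ^ e + (q ^ e)⁻¹ = q + q⁻¹ ∧ q ^ (-2 * e) = (q ^ e)⁻¹ * (q ^ e)⁻¹ := by
  refine ⟨zpow_ne_zero _ hq, ?_, ?_⟩
  · rcases h with rfl | rfl
    · simp
    · simp [add_comm]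
  · rw [← zpow_neg, ← zpow_add₀ hq]; congr 1; ring

theorem hatB_serre (hq : q ≠ 0) (h : GoodB q pl x k Y) (hx : Q45 q M N pl x) (i j : Idx M N) (m n s : ℤ)
      (hc : cc M i.1 j.1 = 1 ∨ cc M i.1 j.1 = -1)
      (hi : i.1 ≠ M) : hatD x k Y (serX q (FreeAlgebra.ι ℂ ((i, m) : Idx M N × ℤ))
        (FreeAlgebra.ι ℂ ((i, n) : Idx M N × ℤ)) (FreeAlgebra.ι ℂ ((j, s) : Idx M N × ℤ))) = 0 := by
  obtain ⟨hii, hij⟩ := cc_serre hc hi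
  have hij' : i ≠ j := fun e => hij (congrArg Subtype.val e)
  have hne : cc M i.1 j.1 ≠ 0 := by rcases hc with e | e <;> simp [e]
  have hnei : cc M i.1 i.1 ≠ 0 := by rw [hii]; rcases hc with e | e <;> simp [e]
  have hce : ce M pl i.1 j.1 = 1 ∨ ce M pl i.1 j.1 = -1 := by
    unfold ce; split_ifs <;> omega
  have hcei : ce M pl i.1 i.1 = -2 * ce M pl i.1 j.1 := by
    unfold ce; split_ifs <;> omega
  obtain ⟨r0, r1, r2⟩ := qr hq hce
  have sii : sgn M i.1 i.1 = 1 := sgn_of_cc hnei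
  have sij : sgn M i.1 j.1 = 1 := sgn_of_cc hne
  have sji : sgn M j.1 i.1 = 1 := by rw [sgn_symm]; exact sij
  have hxx := hx.c1 i i hnei
  rw [hcei, r2] at hxx
  have hxy := hx.c1 i j hne
  simp only [serX, map_add, map_sub, map_smul, map_mul, hatD_mul, ev_ι, hl]
  by_cases hik : i = k
  · subst hik
    have hYi := h.2 i
    rw [hcei, r2] at hYi
    have t1 := T6iq r0 r1 h.1 hYi (h.2 j) hxy m n s
    have t2 := T6iq r0 r1 h.1 hYi (h.2 j) hxy n m s
    simp only [hatD_same, hatD_ne x hij'.symm, sii, sij, one_smul, mul_zero, zero_mul, add_zero, zero_add,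
      mul_add, add_mul, smul_add, mul_assoc] at t1 t2 ⊢
    linear_combination (norm := module) t1 + t2
  · by_cases hjk : j = k
    · subst hjk
      have hYi := h.2 i
      rw [ce_symm] at hYi
      have t1 := T6jq r0 r1 h.1 hYi hxx s m n
      simp only [hatD_same, hatD_ne x hij', sji, one_smul, mul_zero, zero_mul, add_zero, zero_add,
        mul_add, add_mul, smul_add, mul_assoc] at t1 ⊢
      linear_combination (norm := module) t1
    · simp [hatD_ne x hik, hatD_ne x hjk]

theorem hatB_osc (hq : q ≠ 0) (h : GoodB q pl x k Y) (hx : Q45 q M N pl x) (T : Tri M N) (m n s u : ℤ) :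
    hatD x k Y 
      (oscX q (FreeAlgebra.ι ℂ ((T.a, m) : Idx M N × ℤ)) (FreeAlgebra.ι ℂ ((T.b, n) : Idx M N × ℤ))
        (FreeAlgebra.ι ℂ ((T.c, s) : Idx M N × ℤ)) (FreeAlgebra.ι ℂ ((T.b, u) : Idx M N × ℤ)) +
      oscX q (FreeAlgebra.ι ℂ ((T.a, m) : Idx M N × ℤ)) (FreeAlgebra.ι ℂ ((T.b, u) : Idx M N × ℤ))
        (FreeAlgebra.ι ℂ ((T.c, s) : Idx M N × ℤ)) (FreeAlgebra.ι ℂ ((T.b, n) : Idx M N × ℤ))) = 0 := by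
  obtain ⟨a, b, c, ha, hb, hc⟩ := T
  have ha0 := a.2
  have ha' : a.1 = M - 1 := by omega
  have hM : 1 < M := by omega
  have cab : cc M a.1 b.1 = -1 := by rw [ha', hb]; exact cc_ab hM
  have cbc : cc M b.1 c.1 = 1 := by rw [hb, hc]; exact cc_bc
  have cac : cc M a.1 c.1 = 0 := by rw [ha', hc]; exact cc_ac hM
  have cbb : cc M b.1 b.1 = 0 := by rw [hb]; exact cc_MM M
  have nab : a ≠ b := fun e => by have := congrArg Subtype.val e; omega
  have nac : a ≠ c := fun e => by have := congrArg Subtype.val e; omega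
  have nbc : b ≠ c := fun e => by have := congrArg Subtype.val e; omega
  have hp := qr hq (e := ce M pl b.1 c.1) (by unfold ce; split_ifs <;> omega)
  have eab : q ^ ce M pl a.1 b.1 = (q ^ ce M pl b.1 c.1)⁻¹ := by
    rw [← zpow_neg]; congr 1; unfold ce; split_ifs <;> omega
  obtain ⟨p0, p1, -⟩ := hp
  have p1' : (q ^ ce M pl b.1 c.1)⁻¹ + ((q ^ ce M pl b.1 c.1)⁻¹)⁻¹ = q + q⁻¹ := by
    rw [inv_inv, add_comm]; exact p1
  have xab := hx.c1 a b (by omega)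
  rw [eab] at xab
  have xbc := hx.c1 b c (by omega)
  have xac : ∀ m n, x a m * x c n = x c n * x a m := fun m n => by
    rw [hx.c0 a c cac, sgn_of_ne (by omega), one_smul]
  have xbb : ∀ m n, x b m * x b n = -(x b n * x b m) := fun m n => by
    rw [hx.c0 b b cbb, hb, sgn_MM, neg_one_smul]
  have sab : sgn M a.1 b.1 = 1 := sgn_of_ne (by omega)
  have sba : sgn M b.1 a.1 = 1 := sgn_of_ne (by omega)
  have saa : sgn M a.1 a.1 = 1 := sgn_of_ne (by omega)
  have sac : sgn M a.1 c.1 = 1 := sgn_of_ne (by omega)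
  have sca : sgn M c.1 a.1 = 1 := sgn_of_ne (by omega)
  have scb : sgn M c.1 b.1 = 1 := sgn_of_ne (by omega)
  have sbc : sgn M b.1 c.1 = 1 := sgn_of_ne (by omega)
  have sbb : sgn M b.1 b.1 = -1 := by rw [hb]; exact sgn_MM M
  simp only [oscX, map_add, map_sub, map_smul, map_mul, hatD_mul, ev_ι, hl]
  by_cases hka : a = k
  · subst hka
    have hYb := h.2 b
    rw [eab] at hYb
    have hYc : ∀ m n, Y m * x c n = x c n * Y m := h.comm cac
    have t := T7a p0 p1 h.1 hYb hYc xbb xbc m n s u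
    have e1 : x c s * (Y m * (x b n * x b u)) = - (x c s * (Y m * (x b u * x b n))) := by
      rw [xbb n u]; simp
    have e2 : x b u * (x b n * (Y m * x c s)) = - (x b n * (x b u * (Y m * x c s))) := by
      rw [← mul_assoc, xbb u n]; simp [mul_assoc]
    have e3 : x b u * (x c s * (Y m * x b n)) = x b u * (Y m * (x c s * x b n)) := by
      rw [← mul_assoc (x c s), ← hYc, mul_assoc]
    have e4 : x b n * (x c s * (Y m * x b u)) = x b n * (Y m * (x c s * x b u)) := by
      rw [← mul_assoc (x c s), ← hYc, mul_assoc]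
    simp only [hatD_same, hatD_ne x nab.symm, hatD_ne x nac.symm, saa, sab, sac, one_smul, mul_zero, zero_mul, add_zero, zero_add,
      mul_add, add_mul, smul_add, mul_assoc] at t ⊢
    linear_combination (norm := module) t - q • e1 - q⁻¹ • e2 - q • e3 - q • e4
  by_cases hkc : c = k
  · subst hkc
    have hYb := h.2 b
    rw [ce_symm, ← inv_inv (q ^ ce M pl b.1 c.1)] at hYb
    have hYa : ∀ m n, Y m * x a n = x a n * Y m := h.comm (by rw [cc_symm]; exact cac)
    have t := T7a (inv_ne_zero p0) p1' h.1 hYb hYa xbb xab.symm s n m u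
    have e1 : Y s * (x a m * (x b n * x b u)) = - (Y s * (x a m * (x b u * x b n))) := by
      rw [xbb n u]; simp
    have e2 : x b u * (x b n * (x a m * Y s)) = - (x b n * (x b u * (x a m * Y s))) := by
      rw [← mul_assoc, xbb u n]; simp [mul_assoc]
    have e3 : x b u * (x a m * (Y s * x b n)) = x b u * (Y s * (x a m * x b n)) := by
      rw [← mul_assoc (x a m), ← hYa, mul_assoc]
    have e4 : x b n * (x a m * (Y s * x b u)) = x b n * (Y s * (x a m * x b u)) := by
      rw [← mul_assoc (x a m), ← hYa, mul_assoc]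
    simp only [hatD_same, hatD_ne x nac, hatD_ne x nbc, sca, scb, one_smul, mul_zero, zero_mul, add_zero, zero_add,
      mul_add, add_mul, smul_add, mul_assoc] at t ⊢
    linear_combination (norm := module) t - q • e1 - q⁻¹ • e2 - q⁻¹ • e3 - q⁻¹ • e4
  by_cases hkb : b = k
  · subst hkb
    have hYa := h.2 a
    rw [ce_symm, eab] at hYa
    have hYb : ∀ m n, Y m * x b n = x b n * Y m := h.comm cbb
    have t1 := T7b p0 p1 h.1 hYa hYb (h.2 c) xab xbc xac m n s u
    have t2 := T7b p0 p1 h.1 hYa hYb (h.2 c) xab xbc xac m u s n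
    have e1 : x c s * (x a m * (Y n * x b u)) = x c s * (x a m * (x b u * Y n)) := by
      rw [hYb]
    have e2 : x c s * (x a m * (Y u * x b n)) = x c s * (x a m * (x b n * Y u)) := by
      rw [hYb]
    have e3 : Y n * (x b u * (x a m * x c s)) = x b u * (Y n * (x a m * x c s)) := by
      rw [← mul_assoc, hYb, mul_assoc]
    have e4 : Y u * (x b n * (x a m * x c s)) = x b n * (Y u * (x a m * x c s)) := by
      rw [← mul_assoc, hYb, mul_assoc]
    have f1 : ∀ z w, z * (x c s * (x a m * w)) = z * (x a m * (x c s * w)) := fun z w => by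
      rw [← mul_assoc (x c s), ← xac, mul_assoc]
    have g1 := f1 (Y u) (x b n)
    have g2 := f1 (Y n) (x b u)
    have g3 := f1 (x b u) (Y n)
    have g4 := f1 (x b n) (Y u)
    simp only [hatD_same, hatD_ne x nab, hatD_ne x nbc.symm, sba, sbb, sbc, one_smul, neg_one_smul, mul_zero, zero_mul, add_zero, zero_add,
      mul_add, add_mul, smul_add, mul_assoc, neg_mul, mul_neg, neg_neg] at t1 t2 ⊢
    linear_combination (norm := module) t1 + t2 - q • e1 - q • e2 - q⁻¹ • e3 - q⁻¹ • e4
      - q • g1 - q • g2 + q • g3 + q • g4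
  · simp [hatD_ne x hka, hatD_ne x hkb, hatD_ne x hkc]

theorem hatD_add (Y1 Y2 : ℤ → A) (hY : ∀ n, Y n = Y1 n + Y2 n) (w) :
    hatD x k Y w = hatD x k Y1 w + hatD x k Y2 w := by
  unfold hatD
  rw [← tw_add]
  congr 2
  funext g
  simp only [hy]
  split_ifs <;> simp [hY]

theorem hat_low0 (h : Good q pl x k Y) (i j : Idx M N) (m n : ℤ) (hc : cc M i.1 j.1 = 0) :
    hatD x k Y (FreeAlgebra.ι ℂ ((i, m) : Idx M N × ℤ) * FreeAlgebra.ι ℂ ((j, n) : Idx M N × ℤ) -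
          sgn M i.1 j.1 •
            (FreeAlgebra.ι ℂ ((j, n) : Idx M N × ℤ) * FreeAlgebra.ι ℂ ((i, m) : Idx M N × ℤ)))
      = hatD x k Y 0 := by
  obtain ⟨Y1, Y2, h1, h2, e⟩ := h
  rw [hatD_add Y1 Y2 e, hatB_comm0 h1 i j m n hc, hatB_comm0 h2 i j m n hc, map_zero, add_zero]

theorem hat_low2 (h : Good q pl x k Y) (i j : Idx M N) (m n : ℤ) (hc : cc M i.1 j.1 ≠ 0) :
    hatD x k Y
        (FreeAlgebra.ι ℂ ((i, m + 1) : Idx M N × ℤ) * FreeAlgebra.ι ℂ ((j, n) : Idx M N × ℤ) -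
          (q ^ (ce M pl i.1 j.1)) •
            (FreeAlgebra.ι ℂ ((j, n) : Idx M N × ℤ) *
              FreeAlgebra.ι ℂ ((i, m + 1) : Idx M N × ℤ)))
    = hatD x k Y ((q ^ (ce M pl i.1 j.1)) •
            (FreeAlgebra.ι ℂ ((i, m) : Idx M N × ℤ) *
              FreeAlgebra.ι ℂ ((j, n + 1) : Idx M N × ℤ)) -
          FreeAlgebra.ι ℂ ((j, n + 1) : Idx M N × ℤ) * FreeAlgebra.ι ℂ ((i, m) : Idx M N × ℤ)) := by
  obtain ⟨Y1, Y2, h1, h2, e⟩ := h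
  rw [hatD_add Y1 Y2 e, hatD_add Y1 Y2 e, hatB_deg2 h1 i j m n hc, hatB_deg2 h2 i j m n hc]

theorem hat_all (hq : q ≠ 0) (h : Good q pl x k Y) (hx : Q45 q M N pl x) {a b}
    (hab : rel1 q M N pl a b) : hatD x k Y a = hatD x k Y b := by
  revert hab
  apply rel1_cases hq (P := fun a b => hatD x k Y a = hatD x k Y b)
  · exact hat_low0 h
  · exact hat_low2 h
  · intro i j m n s hc hi
    obtain ⟨Y1, Y2, h1, h2, e⟩ := h
    rw [hatD_add Y1 Y2 e, hatB_serre hq h1 hx i j m n s hc hi, hatB_serre hq h2 hx i j m n s hc hi,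
      map_zero, add_zero]
  · intro T m n s u
    obtain ⟨Y1, Y2, h1, h2, e⟩ := h
    rw [hatD_add Y1 Y2 e, hatB_osc hq h1 hx T, hatB_osc hq h2 hx T,
      map_zero, add_zero]

end hat
end QAS

set_option linter.all false
set_option linter.unusedSectionVars false
set_option linter.unusedSimpArgs false
namespace QAS

section expo
variable {A : Type} [Ring A] [Algebra ℂ A]

theorem expC_zero (t : ℂ) (a : ℕ → A) : expC t a 0 = 1 := by rw [expC]

theorem expC_succ (t : ℂ) (a : ℕ → A) (n : ℕ) :
    ((n : ℂ) + 1) • expC t a (n + 1) =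
      ∑ s ∈ Finset.range (n + 1), (t * ((s : ℂ) + 1)) • (a (s + 1) * expC t a (n - s)) := by
  rw [expC, smul_smul, mul_inv_cancel₀ (Nat.cast_add_one_ne_zero n), one_smul, Finset.smul_sum]
  simp only [smul_smul]

theorem map_expC {B : Type} [Ring B] [Algebra ℂ B] (f : A →ₐ[ℂ] B) (t : ℂ) (a : ℕ → A) (n : ℕ) :
    f (expC t a n) = expC t (fun s => f (a s)) n := by
  induction n using Nat.strong_induction_on with
  | _ n ih =>
    cases n with
    | zero => simp [expC_zero]
    | succ n =>
      rw [expC, expC]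
      simp only [map_smul, map_sum, map_mul]
      congr 2
      apply Finset.sum_congr rfl
      intro s hs
      rw [ih (n - s) (by omega)]

theorem expC_congr {t : ℂ} {a b : ℕ → A} (h : ∀ s, a (s + 1) = b (s + 1)) (n : ℕ) :
    expC t a n = expC t b n := by
  induction n using Nat.strong_induction_on with
  | _ n ih =>
    cases n with
    | zero => simp [expC_zero]
    | succ n =>
      rw [expC, expC]
      congr 2
      apply Finset.sum_congr rfl
      intro s hs
      rw [ih (n - s) (by omega), h]

/-- shift by one of a sequence. -/
def dn (F : ℕ → ℤ → A) : ℕ → ℤ → A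
  | 0, _ => 0
  | n + 1, k => F n k

theorem tele (ν : ℂ) (F : ℕ → ℤ → A) (n : ℕ) (k : ℤ) :
    ∑ s ∈ Finset.range (n + 1), ν ^ (s + 1) • (F (n - s) (k + (s + 1 : ℕ)) -
      ν • dn F (n - s) (k + (s + 1 : ℕ) + 1)) = ν • F n (k + 1) := by
  induction n generalizing k with
  | zero => simp [dn]
  | succ n ih =>
    rw [Finset.sum_range_succ']
    have : ∀ s ∈ Finset.range (n + 1), ν ^ (s + 1 + 1) • (F (n + 1 - (s + 1)) (k + (s + 1 + 1 : ℕ)) -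
      ν • dn F (n + 1 - (s + 1)) (k + (s + 1 + 1 : ℕ) + 1)) =
      ν • (ν ^ (s + 1) • (F (n - s) ((k + 1) + (s + 1 : ℕ)) -
      ν • dn F (n - s) ((k + 1) + (s + 1 : ℕ) + 1))) := by
      intro s hs
      rw [show n + 1 - (s + 1) = n - s by omega, show k + ((s + 1 + 1 : ℕ) : ℤ) = k + 1 + ((s + 1 : ℕ) : ℤ) by push_cast; ring,
        smul_smul ν, ← pow_succ']
    rw [Finset.sum_congr rfl this, ← Finset.smul_sum, ih]
    simp only [Nat.sub_zero, dn, zero_add, pow_one, Nat.cast_one]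
    module

theorem dn_rec {F : ℕ → ℤ → A} {G : ℕ → ℕ → ℤ → A}
    (h : ∀ (n : ℕ) (k : ℤ), ((n : ℂ) + 1) • F (n + 1) k = ∑ s ∈ Finset.range (n + 1), G s (n - s) k)
    (n : ℕ) (k : ℤ) :
    (n : ℂ) • F n k = ∑ s ∈ Finset.range (n + 1), dn (G s) (n - s) k := by
  cases n with
  | zero => simp [dn]
  | succ n =>
    rw [Finset.sum_range_succ]
    simp only [Nat.sub_self, dn, add_zero]
    push_cast
    rw [h]
    apply Finset.sum_congr rfl
    intro s hs
    have := Finset.mem_range.1 hs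
    rw [show n + 1 - s = (n - s) + 1 by omega]

variable {t μ : ℂ} {h : ℕ → A} {x : ℤ → A}

theorem phi_exch_aux (hμ : μ ≠ 0)
    (H : ∀ (s : ℕ) (k : ℤ), (t * ((s : ℂ) + 1)) • (h (s + 1) * x k - x k * h (s + 1)) =
      (μ ^ (s + 1) - μ⁻¹ ^ (s + 1)) • x (k + (s + 1 : ℕ))) (n : ℕ) (k : ℤ) :
    expC t h n * x k - μ • dn (fun n k => expC t h n * x k) n (k + 1) =
    x k * expC t h n - μ⁻¹ • dn (fun n k => x k * expC t h n) n (k + 1) := by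
  set F : ℕ → ℤ → A := fun n k => expC t h n * x k with hF
  set F' : ℕ → ℤ → A := fun n k => x k * expC t h n with hF'
  set a : ℕ → A := fun s => (t * ((s : ℂ) + 1)) • h (s + 1) with ha
  have rF : ∀ (n : ℕ) (k : ℤ), ((n : ℂ) + 1) • F (n + 1) k = ∑ s ∈ Finset.range (n + 1), a s * F (n - s) k := by
    intro n k
    simp only [hF, ha]
    rw [← smul_mul_assoc, expC_succ, Finset.sum_mul]
    simp only [smul_mul_assoc, mul_assoc]
  have rF' : ∀ (n : ℕ) (k : ℤ), ((n : ℂ) + 1) • F' (n + 1) k = ∑ s ∈ Finset.range (n + 1),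
      (a s * F' (n - s) k - (μ ^ (s + 1) - μ⁻¹ ^ (s + 1)) • F' (n - s) (k + (s + 1 : ℕ))) := by
    intro n k
    simp only [hF', ha]
    rw [← mul_smul_comm, expC_succ, Finset.mul_sum]
    apply Finset.sum_congr rfl
    intro s hs
    have := congrArg (· * expC t h (n - s)) (H s k)
    simp only [smul_mul_assoc, mul_smul_comm, sub_mul, smul_sub, mul_assoc] at this ⊢
    linear_combination (norm := module) -this
  have dF := dn_rec rF (G := fun s n k => a s * F n k)
  have dF' := dn_rec rF' (G := fun s n k => a s * F' n k - (μ ^ (s + 1) - μ⁻¹ ^ (s + 1)) • F' n (k + (s + 1 : ℕ)))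
  have ed : ∀ s n k, dn (fun n k => a s * F n k) n k = a s * dn F n k := by
    intro s n k; cases n <;> simp [dn]
  have ed' : ∀ s n k, dn (fun n k => a s * F' n k - (μ ^ (s + 1) - μ⁻¹ ^ (s + 1)) • F' n (k + (s + 1 : ℕ))) n k
      = a s * dn F' n k - (μ ^ (s + 1) - μ⁻¹ ^ (s + 1)) • dn F' n (k + (s + 1 : ℕ)) := by
    intro s n k; cases n <;> simp [dn]
  simp only [ed] at dF
  simp only [ed'] at dF'
  induction n using Nat.strong_induction_on generalizing k with
  | _ n ih =>
    cases n with
    | zero => simp [dn, hF, hF', expC_zero]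
    | succ n =>
      have ne : ((n : ℂ) + 1) ≠ 0 := Nat.cast_add_one_ne_zero n
      have key : ((n : ℂ) + 1) • (F (n + 1) k - μ • F n (k + 1)) =
          ((n : ℂ) + 1) • (F' (n + 1) k - μ⁻¹ • F' n (k + 1)) := by
        have L1 : ((n : ℂ) + 1) • (F (n + 1) k - μ • F n (k + 1)) =
            ∑ s ∈ Finset.range (n + 1), (a s * (F (n - s) k - μ • dn F (n - s) (k + 1)) -
              μ ^ (s + 1) • (F (n - s) (k + (s + 1 : ℕ)) - μ • dn F (n - s) (k + (s + 1 : ℕ) + 1))) := by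
          rw [Finset.sum_sub_distrib, tele]
          simp only [mul_sub, mul_smul_comm, Finset.sum_sub_distrib, ← Finset.smul_sum]
          rw [← rF, ← dF]
          module
        have L2 : ((n : ℂ) + 1) • (F' (n + 1) k - μ⁻¹ • F' n (k + 1)) =
            ∑ s ∈ Finset.range (n + 1), (a s * (F' (n - s) k - μ⁻¹ • dn F' (n - s) (k + 1)) -
              μ ^ (s + 1) • (F' (n - s) (k + (s + 1 : ℕ)) - μ⁻¹ • dn F' (n - s) (k + (s + 1 : ℕ) + 1))) := by
          have t1 := tele μ⁻¹ F' n k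
          have r1 := rF' n k
          have r2 := dF' n (k + 1)
          have : ∑ s ∈ Finset.range (n + 1), (a s * (F' (n - s) k - μ⁻¹ • dn F' (n - s) (k + 1)) -
              μ ^ (s + 1) • (F' (n - s) (k + (s + 1 : ℕ)) - μ⁻¹ • dn F' (n - s) (k + (s + 1 : ℕ) + 1)))
            = ∑ s ∈ Finset.range (n + 1), (a s * F' (n - s) k - (μ ^ (s + 1) - μ⁻¹ ^ (s + 1)) • F' (n - s) (k + (s + 1 : ℕ)))
            - μ⁻¹ • ∑ s ∈ Finset.range (n + 1), (a s * dn F' (n - s) (k + 1) - (μ ^ (s + 1) - μ⁻¹ ^ (s + 1)) • dn F' (n - s) (k + 1 + (s + 1 : ℕ)))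
            - ∑ s ∈ Finset.range (n + 1), μ⁻¹ ^ (s + 1) • (F' (n - s) (k + (s + 1 : ℕ)) -
      μ⁻¹ • dn F' (n - s) (k + (s + 1 : ℕ) + 1)) := by
            rw [Finset.smul_sum, ← Finset.sum_sub_distrib, ← Finset.sum_sub_distrib]
            apply Finset.sum_congr rfl
            intro s hs
            rw [show k + 1 + ((s + 1 : ℕ) : ℤ) = k + ((s + 1 : ℕ) : ℤ) + 1 by ring]
            simp only [mul_sub, mul_smul_comm]
            module
          rw [this, t1, ← r1, ← r2]
          module
        rw [L1, L2]
        apply Finset.sum_congr rfl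
        intro s hs
        rw [ih (n - s) (by omega) k, ih (n - s) (by omega) (k + (s + 1 : ℕ))]
      have := congrArg (((n : ℂ) + 1)⁻¹ • ·) key
      simp only [smul_smul, inv_mul_cancel₀ ne, one_smul] at this
      exact this

theorem phi_exch (hμ : μ ≠ 0) {K : A} (hK : ∀ n, K * x n = μ • (x n * K))
    (H : ∀ (s : ℕ) (k : ℤ), (t * ((s : ℂ) + 1)) • (h (s + 1) * x k - x k * h (s + 1)) =
      (μ ^ (s + 1) - μ⁻¹ ^ (s + 1)) • x (k + (s + 1 : ℕ))) :
    Ex 1 μ (fun n : ℤ => if 0 ≤ n then K * expC t h n.toNat else 0) x := by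
  intro m n
  simp only [one_smul]
  by_cases hm : 0 ≤ m
  · obtain ⟨m, rfl⟩ := Int.eq_ofNat_of_zero_le hm
    rw [if_pos (by omega), if_pos (by omega)]
    have e := phi_exch_aux hμ H (m + 1) n
    simp only [dn] at e
    have e' := congrArg (K * ·) e
    simp only [mul_sub, mul_smul_comm] at e'
    have k1 : ∀ n (w : A), K * (x n * w) = μ • (x n * (K * w)) := by
      intro n w; rw [← mul_assoc, hK, smul_mul_assoc, mul_assoc]
    rw [k1, k1, smul_smul, inv_mul_cancel₀ hμ, one_smul] at e'
    rw [show ((m : ℤ) + 1).toNat = m + 1 by omega, show ((m : ℤ)).toNat = m by omega]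
    simp only [mul_assoc]
    linear_combination (norm := module) e'
  · by_cases hm' : m = -1
    · subst hm'
      simp [expC_zero, hK]
    · rw [if_neg (by omega), if_neg (by omega)]
      simp

/-- the two Cartan currents in an arbitrary algebra. -/
def phP (t : ℂ) (K : A) (h : ℤ → A) (n : ℤ) : A :=
  if 0 ≤ n then K * expC t (fun s => h (s : ℤ)) n.toNat else 0

def phM (t : ℂ) (Ki : A) (h : ℤ → A) (n : ℤ) : A :=
  if n ≤ 0 then Ki * expC (-t) (fun s => h (-(s : ℤ))) (-n).toNat else 0

theorem phP_Bdd (K : A) (h : ℤ → A) : Bdd (phP t K h) :=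
  ⟨0, Or.inl fun n hn => by simp [phP, not_le.2 hn]⟩

theorem phM_Bdd (K : A) (h : ℤ → A) : Bdd (phM t K h) :=
  ⟨0, Or.inr fun n hn => by simp [phM, not_le.2 hn]⟩

theorem phP_Ex (hμ : μ ≠ 0) {K : A} {h : ℤ → A} (hK : ∀ n, K * x n = μ • (x n * K))
    (H : ∀ (s : ℤ), s ≠ 0 → ∀ k, (t * s) • (h s * x k - x k * h s) = (μ ^ s - μ ^ (-s)) • x (k + s)) :
    Ex 1 μ (phP t K h) x := by
  refine phi_exch hμ hK (h := fun s => h (s : ℤ)) ?_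
  intro s k
  have := H ((s + 1 : ℕ) : ℤ) (by omega) k
  rw [zpow_neg, zpow_natCast, ← inv_pow] at this
  push_cast at this ⊢
  exact this

theorem phM_Ex (hμ : μ ≠ 0) {K : A} {h : ℤ → A} (hK : ∀ n, K * x n = μ⁻¹ • (x n * K))
    (H : ∀ (s : ℤ), s ≠ 0 → ∀ k, (t * s) • (h s * x k - x k * h s) = (μ ^ s - μ ^ (-s)) • x (k + s)) :
    Ex 1 μ (phM t K h) x := by
  have E := phi_exch (t := -t) (inv_ne_zero hμ) (x := fun n => x (-n)) (fun n => hK (-n))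
    (h := fun s => h (-(s : ℤ))) ?_
  · intro a b
    have e := congrArg (μ • ·) (E (-a - 1) (-b - 1))
    simp only [smul_sub, one_smul, smul_smul, mul_inv_cancel₀ hμ] at e
    rw [show -a - 1 + 1 = -a by ring, show -(-b - 1) = b + 1 by ring, show -(-b - 1 + 1) = b by ring] at e
    rw [show -a - 1 = -(a + 1) by ring] at e
    simp only [Left.nonneg_neg_iff] at e
    simp only [phM, one_smul]
    linear_combination (norm := module) - e
  · intro s k
    have := H (-((s + 1 : ℕ) : ℤ)) (by omega) (-k)
    rw [neg_neg, zpow_neg, zpow_natCast, ← inv_pow] at this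
    rw [inv_inv, show -(k + ((s + 1 : ℕ) : ℤ)) = -k + -((s + 1 : ℕ) : ℤ) by ring, ← this]
    push_cast
    congr 1
    ring

end expo
end QAS

set_option linter.all false
set_option linter.unusedSectionVars false
set_option linter.unusedSimpArgs false
namespace QAS

section pres
variable {q : ℂ} {M N : ℕ} {pl : Bool} {V : Type} [Ring V] [Algebra ℂ V] {X : Idx M N → ℤ → V}

/-- `V` is the algebra presented by the one-sided relations. -/
structure Pres (q : ℂ) (M N : ℕ) (pl : Bool) (V : Type) [Ring V] [Algebra ℂ V]
    (X : Idx M N → ℤ → V) : Prop where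
  sat : Sat q M N pl X
  ind : ∀ S : Submodule ℂ V, (1 : V) ∈ S → (∀ i m v, v ∈ S → X i m * v ∈ S) → S = ⊤
  lift : ∀ (A : Type) [Ring A] [Algebra ℂ A] (x : Idx M N → ℤ → A), Sat q M N pl x →
    ∃ f : V →ₐ[ℂ] A, ∀ i m, f (X i m) = x i m

theorem Sat.map {A B : Type} [Ring A] [Algebra ℂ A] [Ring B] [Algebra ℂ B] (f : A →ₐ[ℂ] B)
    {x : Idx M N → ℤ → A} (h : Sat q M N pl x) : Sat q M N pl (fun i m => f (x i m)) := by
  intro a b hab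
  have e : ev (fun i m => f (x i m)) = f.comp (ev x) := by
    apply FreeAlgebra.hom_ext
    funext g
    simp [un]
  rw [e]
  simp [h a b hab]

/-- two linear maps agree as soon as they transform equally. -/
theorem Pres.ext (hP : Pres q M N pl V X) {W : Type} [AddCommGroup W] [Module ℂ W]
    {P Q : V →ₗ[ℂ] W} (h1 : P 1 = Q 1)
    (h : ∀ i m v, P v = Q v → P (X i m * v) = Q (X i m * v)) : P = Q := by
  have := hP.ind (LinearMap.eqLocus P Q) h1 h
  ext v
  have hv : v ∈ LinearMap.eqLocus P Q := by rw [this]; trivial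
  exact hv

theorem Pres.ex_tw (hP : Pres q M N pl V X) {A : Type} [Ring A] [Algebra ℂ A]
    {l r : Idx M N → ℤ → A} {y : Idx M N × ℤ → A} (hl : Sat q M N pl l) (hr : Sat q M N pl r)
    (hy : ∀ a b, rel1 q M N pl a b → tw (un l) y (un r) a = tw (un l) y (un r) b) :
    ∃ F R : V →ₗ[ℂ] A, F 1 = 0 ∧ R 1 = 1 ∧
      (∀ i m v, F (X i m * v) = l i m * F v + y (i, m) * R v) ∧
      (∀ i m v, R (X i m * v) = r i m * R v) := by
  obtain ⟨ρ, hρ⟩ := hP.lift (Matrix (Fin 2) (Fin 2) A)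
    (fun i m => !![l i m, y (i, m); 0, r i m]) (by
      intro a b hab
      exact tw_eq_utH (hl a b hab) (hr a b hab) (hy a b hab))
  let F : V →ₗ[ℂ] A := { toFun := fun v => ρ v 0 1, map_add' := by simp, map_smul' := by simp }
  let R : V →ₗ[ℂ] A := { toFun := fun v => ρ v 1 1, map_add' := by simp, map_smul' := by simp }
  refine ⟨F, R, by simp [F], by simp [R], ?_, ?_⟩
  · intro i m v
    simp [F, R, hρ, Matrix.mul_apply]
  · intro i m v
    simp [F, R, hρ, Matrix.mul_apply]

theorem Pres.ex_K (hq : q ≠ 0) (hP : Pres q M N pl V X) (f : Idx M N → ℂ) (hf : ∀ i, f i ≠ 0) :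
    ∃ K : Module.End ℂ V, K 1 = 1 ∧ ∀ j m v, K (X j m * v) = f j • (X j m * K v) := by
  obtain ⟨σ, hσ⟩ := hP.lift V _ (hP.sat.scale hq f hf)
  exact ⟨σ.toLinearMap, by simp, fun j m v => by simp [hσ]⟩

theorem Pres.ex_D (hq : q ≠ 0) (hP : Pres q M N pl V X) (d : Idx M N → ℂ) (s : ℤ) :
    ∃ D : Module.End ℂ V, D 1 = 0 ∧
      ∀ j m v, D (X j m * v) = X j m * D v + d j • (X j (m + s) * v) := by
  obtain ⟨F, R, h1, h2, h3, h4⟩ := hP.ex_tw hP.sat hP.sat (fun a b hab => hP.sat.shift hq d s hab)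
  have hR : R = LinearMap.id := hP.ext (by simp [h2]) (fun i m v hv => by rw [h4, hv]; simp)
  refine ⟨F, h1, fun j m v => ?_⟩
  rw [h3, hR]
  simp

/-- left multiplications. -/
def Lm (X : Idx M N → ℤ → V) (i : Idx M N) (m : ℤ) : Module.End ℂ V := Algebra.lmul ℂ V (X i m)

theorem Lm_apply (i : Idx M N) (m : ℤ) (v : V) : Lm X i m v = X i m * v := rfl

theorem Pres.satL (hP : Pres q M N pl V X) : Sat q M N pl (Lm X) := hP.sat.map (Algebra.lmul ℂ V)

theorem Pres.ex_E (hq : q ≠ 0) (hP : Pres q M N pl V X) (k : Idx M N) {Y : ℤ → Module.End ℂ V}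
    (hY : Good q pl (Lm X) k Y) :
    ∃ E : Module.End ℂ V, E 1 = 0 ∧
      ∀ j m v, E (X j m * v) = sgn M k.1 j.1 • (X j m * E v) + if j = k then Y m v else 0 := by
  obtain ⟨F, R, h1, h2, h3, h4⟩ := hP.ex_tw (l := hl k (Lm X)) (y := hy k Y)
    (hP.satL.scale hq (fun i => sgn M k.1 i.1) (fun i => sgn_ne _ _ _)) hP.satL
    (fun a b hab => hat_all hq hY hP.satL.q45 hab)
  have hR : R = (Algebra.lmul ℂ V).toLinearMap := hP.ext
    (by rw [h2]; exact (map_one (Algebra.lmul ℂ V)).symm) (fun i m v hv => by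
    rw [h4, hv]; exact (map_mul (Algebra.lmul ℂ V) (X i m) v).symm)
  let E : Module.End ℂ V := { toFun := fun v => F v 1, map_add' := by simp, map_smul' := by simp }
  refine ⟨E, by simp [E, h1], fun j m v => ?_⟩
  simp only [E, LinearMap.coe_mk, AddHom.coe_mk]
  rw [h3, hR]
  simp only [hl, hy, LinearMap.add_apply, Module.End.mul_apply, LinearMap.smul_apply, Lm_apply]
  congr 1
  by_cases h : j = k <;> simp [h]

/-- evaluation at the vacuum. -/
theorem ev_vac (hq : q ≠ 0) {E : Idx M N → ℤ → Module.End ℂ V} (hE : ∀ i n, E i n 1 = 0) {a b}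
    (hab : rel1 q M N pl a b) : ev E (a - b) 1 = 0 := by
  revert hab
  apply rel1_cases hq (P := fun a b => ev E (a - b) 1 = 0)
  · intro i j m n h
    simp [un, hE]
  · intro i j m n h
    simp only [map_sub, map_mul, map_smul, ev_ι]
    simp only [LinearMap.sub_apply, LinearMap.smul_apply, Module.End.mul_apply, hE, map_zero,
      smul_zero, sub_zero]
  · intro i j m n k h hi
    simp [un, serX, hE]
  · intro T m n k u
    simp [un, oscX, hE]

/-- the opposite half satisfies the relations. -/
theorem Pres.opp (hq : q ≠ 0) (hP : Pres q M N pl V X) {pl' : Bool} {E : Idx M N → ℤ → Module.End ℂ V}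
    {Φ : Idx M N → ℤ → Module.End ℂ V} (κ : Idx M N → ℂ)
    (h1 : ∀ i n, E i n 1 = 0)
    (h2 : ∀ i n j m v, E i n (X j m * v) = sgn M i.1 j.1 • (X j m * E i n v) +
      if j = i then κ i • Φ i (n + m) v else 0)
    (hG : ∀ k, Good q pl' E k (Φ k)) : Sat q M N pl' E := by
  have step : ∀ a b, rel1 q M N pl' a b →
      (∀ k Y, Good q pl' E k Y → hatD E k Y a = hatD E k Y b) → ev E a = ev E b := by
    intro a b hab H
    rw [← sub_eq_zero, ← map_sub]
    apply hP.ext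
    · rw [ev_vac hq h1 hab]; simp
    intro k m v hv
    obtain ⟨s, hs, e⟩ := rel1_homog hq (fun i => sgn M k.1 i.1) (fun i => sgn_ne _ _ _) hab
    have e1 := e _ E
    have h3 := H k _ ((hG k).affine (-(sgn M k.1 k.1 * κ k)) m)
    rw [← sub_eq_zero, ← map_sub] at h3
    have h4 := tw_inner (un (hl k E)) (un E) (Lm X k m) (a - b)
    have h5 : (fun g => Lm X k m * un E g - un (hl k E) g * Lm X k m) =
        hy k (fun n => (-(sgn M k.1 k.1 * κ k)) • Φ k (n + m)) := by
      funext g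
      obtain ⟨i, n⟩ := g
      ext w
      simp only [un, hl, hy, LinearMap.sub_apply, Module.End.mul_apply, Lm_apply, LinearMap.smul_apply, h2]
      rw [sgn_symm M i.1 k.1, smul_add, smul_smul, sgn_sq, one_smul]
      by_cases hik : i = k
      · subst hik
        simp [smul_smul]
      · simp [hik, Ne.symm hik]
    rw [h5] at h4
    unfold hatD at h3
    rw [h3] at h4
    have h6 : ev (hl k E) (a - b) = s • ev E (a - b) := e1
    have h7 := congrArg (fun T : Module.End ℂ V => T v) h4
    simp only [LinearMap.sub_apply, Module.End.mul_apply, Lm_apply, LinearMap.zero_apply] at h7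
    rw [show FreeAlgebra.lift ℂ (un (hl k E)) (a - b) = s • ev E (a - b) from h6,
      show FreeAlgebra.lift ℂ (un E) (a - b) v = 0 from hv, mul_zero, zero_sub,
      LinearMap.smul_apply] at h7
    have h8 : s • (ev E (a - b)) (X k m * v) = 0 := by simpa using h7.symm
    simpa [hs] using h8
  have hQ : Q45 q M N pl' E := by
    constructor
    · intro i j hc m n
      have := step _ _ (rel1.comm0 i j m n hc) (fun k Y hY => hat_low0 hY i j m n hc)
      simpa [un, sub_eq_zero] using this
    · intro i j hc m n
      have := step _ _ (rel1.deg2 i j m n hc) (fun k Y hY => hat_low2 hY i j m n hc)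
      simp only [map_sub, map_mul, map_smul, ev_ι] at this
      simp only [one_smul]
      exact this
  exact fun a b hab => step a b hab (fun k Y hY => hat_all hq hY hQ hab)

end pres
end QAS

set_option linter.all false
set_option linter.unusedSectionVars false
set_option linter.unusedSimpArgs false
namespace QAS

/-- `q_i - q_i⁻¹`. -/
def tq (q : ℂ) (M i : ℕ) : ℂ := qpar q M i - (qpar q M i)⁻¹

theorem lof_sq (M i : ℕ) : lof M i * lof M i = 1 := by
  unfold lof; split_ifs <;> norm_num

theorem tq_ne {q : ℂ} (hq0 : q ≠ 0) (hq1 : ∀ k : ℕ, k ≠ 0 → q ^ k ≠ 1) (M i : ℕ) : tq q M i ≠ 0 := by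
  have h2 := hq1 2 (by norm_num)
  have h : q - q⁻¹ ≠ 0 := by
    intro h
    apply h2
    have : q = q⁻¹ := sub_eq_zero.1 h
    calc q ^ 2 = q * q := sq q
      _ = q * q⁻¹ := by rw [← this]
      _ = 1 := mul_inv_cancel₀ hq0
  unfold tq qpar lof
  split_ifs
  · simpa using h
  · simp only [zpow_neg, zpow_one, inv_inv]
    intro h'
    apply h
    rw [← neg_eq_zero]; rw [← h']; ring

/-- structure constant of `[h_{i,s}, X_{j,n}]`. -/
def dco (q : ℂ) (M : ℕ) (pl : Bool) (i j : ℕ) (s : ℤ) : ℂ :=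
  (if pl then 1 else -1) * (qint (qpar q M i) (s * lof M i * cc M i j) / (s : ℂ))

theorem dco_not (q : ℂ) (M : ℕ) (pl : Bool) (i j : ℕ) (s : ℤ) :
    dco q M (!pl) i j s = - dco q M pl i j s := by
  unfold dco; cases pl <;> simp

theorem ce_not (M : ℕ) (pl : Bool) (i j : ℕ) : ce M (!pl) i j = - ce M pl i j := by
  unfold ce; cases pl <;> simp

theorem dco_eq {q : ℂ} (hq0 : q ≠ 0) (hq1 : ∀ k : ℕ, k ≠ 0 → q ^ k ≠ 1) (M : ℕ) (pl : Bool)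
    (i j : ℕ) {s : ℤ} (hs : s ≠ 0) :
    tq q M i * s * dco q M pl i j s = (q ^ ce M pl i j) ^ s - (q ^ ce M pl i j) ^ (-s) := by
  have ht := tq_ne hq0 hq1 M i
  have hs' : (s : ℂ) ≠ 0 := by exact_mod_cast hs
  have e : tq q M i * s * dco q M pl i j s = (if pl then 1 else -1) *
      (qpar q M i ^ (s * lof M i * cc M i j) - qpar q M i ^ (-(s * lof M i * cc M i j))) := by
    unfold dco qint
    change _ = _ at *
    rw [show qpar q M i - (qpar q M i)⁻¹ = tq q M i from rfl]
    field_simp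
  have l1 : lof M i * (s * lof M i * cc M i j) = cc M i j * s := by
    linear_combination (s * cc M i j) * lof_sq M i
  rw [e, qpar, ← zpow_mul, ← zpow_mul, ← zpow_mul, ← zpow_mul, mul_neg, l1]
  cases pl <;> simp [ce]

section comm
variable {A : Type} [Ring A] [Algebra ℂ A] {C : A} {t : ℂ}

theorem expC_comm {a : ℕ → A} (h : ∀ s, C * a (s + 1) = a (s + 1) * C) (n : ℕ) :
    C * expC t a n = expC t a n * C := by
  induction n using Nat.strong_induction_on with
  | _ n ih =>
    cases n with
    | zero => simp [expC_zero]
    | succ n =>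
      have hn : (n : ℂ) + 1 ≠ 0 := Nat.cast_add_one_ne_zero n
      have : ((n : ℂ) + 1) • (C * expC t a (n + 1)) = ((n : ℂ) + 1) • (expC t a (n + 1) * C) := by
        rw [← mul_smul_comm, ← smul_mul_assoc, expC_succ, Finset.mul_sum, Finset.sum_mul]
        refine Finset.sum_congr rfl fun s _ => ?_
        rw [mul_smul_comm, smul_mul_assoc, ← mul_assoc, h, mul_assoc, ih _ (by omega), mul_assoc]
      exact smul_right_injective A hn this

theorem phP_comm {K : A} {h : ℤ → A} (hK : C * K = K * C) (hh : ∀ s, C * h s = h s * C) (n : ℤ) :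
    C * phP t K h n = phP t K h n * C := by
  unfold phP
  split_ifs
  · rw [← mul_assoc, hK, mul_assoc, expC_comm (fun s => hh _), mul_assoc]
  · simp

theorem phM_comm {K : A} {h : ℤ → A} (hK : C * K = K * C) (hh : ∀ s, C * h s = h s * C) (n : ℤ) :
    C * phM t K h n = phM t K h n * C := by
  unfold phM
  split_ifs
  · rw [← mul_assoc, hK, mul_assoc, expC_comm (fun s => hh _), mul_assoc]
  · simp

variable {M N : ℕ}
/-- `φ⁺ - φ⁻`. -/
def Ph (q : ℂ) (K Ki : Idx M N → A) (D : Idx M N → ℤ → A) (k : Idx M N) (n : ℤ) : A :=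
  phP (tq q M k.1) (K k) (D k) n - phM (tq q M k.1) (Ki k) (D k) n

theorem Ph_comm {q : ℂ} {K Ki : Idx M N → A} {D : Idx M N → ℤ → A} {k : Idx M N}
    (h1 : C * K k = K k * C) (h2 : C * Ki k = Ki k * C) (h3 : ∀ s, C * D k s = D k s * C) (n : ℤ) :
    C * Ph q K Ki D k n = Ph q K Ki D k n * C := by
  unfold Ph
  rw [mul_sub, sub_mul, phP_comm h1 h3, phM_comm h2 h3]

theorem Ph_good {q : ℂ} (hq0 : q ≠ 0) (hq1 : ∀ k : ℕ, k ≠ 0 → q ^ k ≠ 1) {pl : Bool}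
    {K Ki : Idx M N → A} {D : Idx M N → ℤ → A} {x : Idx M N → ℤ → A}
    (hK : ∀ i j n, K i * x j n = (q ^ ce M pl i.1 j.1) • (x j n * K i))
    (hKi : ∀ i j n, Ki i * x j n = (q ^ ce M pl i.1 j.1)⁻¹ • (x j n * Ki i))
    (hD : ∀ i j s n, D i s * x j n - x j n * D i s = dco q M pl i.1 j.1 s • x j (n + s))
    (k : Idx M N) : Good q pl x k (Ph q K Ki D k) := by
  have H : ∀ j (s : ℤ), s ≠ 0 → ∀ m, (tq q M k.1 * s) • (D k s * x j m - x j m * D k s) =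
      ((q ^ ce M pl k.1 j.1) ^ s - (q ^ ce M pl k.1 j.1) ^ (-s)) • x j (m + s) := by
    intro j s hs m
    rw [hD, smul_smul, dco_eq hq0 hq1 _ _ _ _ hs]
  have g1 : GoodB q pl x k (phP (tq q M k.1) (K k) (D k)) :=
    ⟨phP_Bdd _ _, fun j => phP_Ex (zpow_ne_zero _ hq0) (hK k j) (H j)⟩
  have g2 : GoodB q pl x k (phM (tq q M k.1) (Ki k) (D k)) :=
    ⟨phM_Bdd _ _, fun j => phM_Ex (zpow_ne_zero _ hq0) (hKi k j) (H j)⟩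
  exact ⟨_, _, g1, g2.affine (-1) 0, fun n => by simp [Ph, sub_eq_add_neg]⟩
end comm

section act
variable {q : ℂ} {M N : ℕ} {pl : Bool} {V : Type} [Ring V] [Algebra ℂ V] {X : Idx M N → ℤ → V}

/-- the operators on the one-sided algebra. -/
structure Act (q : ℂ) (M N : ℕ) (pl : Bool) {V : Type} [Ring V] [Algebra ℂ V]
    (X : Idx M N → ℤ → V) (κ : Idx M N → ℂ) (K Ki : Idx M N → Module.End ℂ V)
    (D E : Idx M N → ℤ → Module.End ℂ V) : Prop where
  K1 : ∀ i, K i 1 = 1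
  KX : ∀ i j m v, K i (X j m * v) = (q ^ ce M pl i.1 j.1) • (X j m * K i v)
  Ki1 : ∀ i, Ki i 1 = 1
  KiX : ∀ i j m v, Ki i (X j m * v) = (q ^ ce M pl i.1 j.1)⁻¹ • (X j m * Ki i v)
  D1 : ∀ i s, D i s 1 = 0
  DX : ∀ i s j m v, D i s (X j m * v) = X j m * D i s v +
    dco q M pl i.1 j.1 s • (X j (m + s) * v)
  E1 : ∀ i n, E i n 1 = 0
  EX : ∀ i n j m v, E i n (X j m * v) = sgn M i.1 j.1 • (X j m * E i n v) +
    if j = i then κ i • Ph q K Ki D i (n + m) v else 0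

theorem Pres.ex_act (hq0 : q ≠ 0) (hq1 : ∀ k : ℕ, k ≠ 0 → q ^ k ≠ 1) (hP : Pres q M N pl V X)
    (κ : Idx M N → ℂ) : ∃ K Ki D E, Act q M N pl X κ K Ki D E := by
  choose K hK1 hKX using fun i : Idx M N => hP.ex_K hq0 (fun j => q ^ ce M pl i.1 j.1)
    (fun j => zpow_ne_zero _ hq0)
  choose Ki hKi1 hKiX using fun i : Idx M N => hP.ex_K hq0 (fun j => (q ^ ce M pl i.1 j.1)⁻¹)
    (fun j => inv_ne_zero (zpow_ne_zero _ hq0))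
  choose D hD1 hDX using fun (i : Idx M N) (s : ℤ) =>
    hP.ex_D hq0 (fun j => dco q M pl i.1 j.1 s) s
  have hG : ∀ k, Good q pl (Lm X) k (Ph q K Ki D k) := by
    apply Ph_good hq0 hq1
    · intro i j n; ext v; exact hKX i j n v
    · intro i j n; ext v; exact hKiX i j n v
    · intro i j s n; ext v
      simp only [LinearMap.sub_apply, Module.End.mul_apply, Lm_apply, LinearMap.smul_apply, hDX]
      simp
  choose E hE1 hEX using fun (k : Idx M N) (n : ℤ) => hP.ex_E hq0 k ((hG k).affine (κ k) n)
  refine ⟨K, Ki, D, E, hK1, hKX, hKi1, hKiX, hD1, hDX, hE1, ?_⟩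
  intro i n j m v
  rw [hEX, add_comm m n]
  simp

variable {κ : Idx M N → ℂ} {K Ki : Idx M N → Module.End ℂ V} {D E : Idx M N → ℤ → Module.End ℂ V}

theorem Act.cKKi (hq0 : q ≠ 0) (hP : Pres q M N pl V X) (h : Act q M N pl X κ K Ki D E) (i : Idx M N) :
    K i * Ki i = 1 := by
  apply hP.ext
  · simp [h.K1, h.Ki1]
  · intro j m v hv
    simp only [Module.End.mul_apply, h.K1, h.Ki1, h.KX, h.KiX, map_smul, Module.End.one_apply] at *
    rw [smul_smul, inv_mul_cancel₀ (zpow_ne_zero _ hq0), one_smul, hv]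

theorem Act.cKiK (hq0 : q ≠ 0) (hP : Pres q M N pl V X) (h : Act q M N pl X κ K Ki D E) (i : Idx M N) :
    Ki i * K i = 1 := by
  apply hP.ext
  · simp [h.K1, h.Ki1]
  · intro j m v hv
    simp only [Module.End.mul_apply, h.K1, h.Ki1, h.KX, h.KiX, map_smul, Module.End.one_apply] at *
    rw [smul_smul, mul_inv_cancel₀ (zpow_ne_zero _ hq0), one_smul, hv]

theorem Act.cKK (hP : Pres q M N pl V X) (h : Act q M N pl X κ K Ki D E) (i j : Idx M N) :
    K i * K j = K j * K i := by
  apply hP.ext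
  · simp [h.K1]
  · intro k m v hv
    simp only [Module.End.mul_apply, h.KX, map_smul] at *
    rw [hv, smul_comm]

theorem Act.cKH (hP : Pres q M N pl V X) (h : Act q M N pl X κ K Ki D E) (i j : Idx M N) (s : ℤ) :
    K i * D j s = D j s * K i := by
  apply hP.ext
  · simp [h.K1, h.D1]
  · intro k m v hv
    simp only [Module.End.mul_apply, h.KX, h.DX, map_smul, map_add, smul_add] at *
    rw [hv, smul_comm]

theorem Act.cHH (hP : Pres q M N pl V X) (h : Act q M N pl X κ K Ki D E) (i j : Idx M N) (s t : ℤ) :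
    D i s * D j t = D j t * D i s := by
  apply hP.ext
  · simp [h.D1]
  · intro k m v hv
    simp only [Module.End.mul_apply, h.DX, map_smul, map_add, smul_add] at *
    rw [hv, smul_comm, show m + s + t = m + t + s by ring]
    abel

theorem inv_comm {A : Type} [Ring A] {a b c : A} (h1 : a * b = 1) (h2 : b * a = 1)
    (h : a * c = c * a) : b * c = c * b := by
  calc b * c = b * c * (a * b) := by rw [h1, mul_one]
    _ = b * (c * a) * b := by noncomm_ring
    _ = (b * a) * c * b := by rw [← h]; noncomm_ring
    _ = c * b := by rw [h2, one_mul]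

theorem Act.cKiH (hq0 : q ≠ 0) (hP : Pres q M N pl V X) (h : Act q M N pl X κ K Ki D E)
    (i j : Idx M N) (s : ℤ) : Ki i * D j s = D j s * Ki i :=
  inv_comm (h.cKKi hq0 hP i) (h.cKiK hq0 hP i) (h.cKH hP i j s)

theorem Act.cKiKj (hq0 : q ≠ 0) (hP : Pres q M N pl V X) (h : Act q M N pl X κ K Ki D E)
    (i j : Idx M N) : Ki i * K j = K j * Ki i :=
  inv_comm (h.cKKi hq0 hP i) (h.cKiK hq0 hP i) (h.cKK hP i j)

theorem Act.cKiKi (hq0 : q ≠ 0) (hP : Pres q M N pl V X) (h : Act q M N pl X κ K Ki D E)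
    (i j : Idx M N) : Ki i * Ki j = Ki j * Ki i :=
  inv_comm (h.cKKi hq0 hP i) (h.cKiK hq0 hP i) (h.cKiKj hq0 hP j i).symm

theorem Act.cKE (hq0 : q ≠ 0) (hP : Pres q M N pl V X) (h : Act q M N pl X κ K Ki D E)
    (i k : Idx M N) (n : ℤ) : K i * E k n = (q ^ ce M (!pl) i.1 k.1) • (E k n * K i) := by
  rw [ce_not]
  apply hP.ext
  · simp [h.K1, h.E1]
  · intro j m v hv
    have hΦ : K i (Ph q K Ki D k (n + m) v) = Ph q K Ki D k (n + m) (K i v) :=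
      LinearMap.congr_fun (Ph_comm (h.cKK hP i k) (h.cKiKj hq0 hP k i).symm (h.cKH hP i k) (n + m)) v
    simp only [Module.End.mul_apply, LinearMap.smul_apply, h.KX, h.EX, map_smul, map_add, smul_add] at *
    rw [hv]
    congr 1
    · rw [mul_smul_comm, smul_smul, smul_smul, smul_smul, smul_smul]
      congr 1; ring
    · split_ifs with hj
      · subst hj
        rw [map_smul, hΦ, smul_smul, ← zpow_add₀ hq0]
        simp
      · simp

theorem Act.cKiE (hq0 : q ≠ 0) (hP : Pres q M N pl V X) (h : Act q M N pl X κ K Ki D E)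
    (i k : Idx M N) (n : ℤ) : Ki i * E k n = (q ^ ce M (!pl) i.1 k.1)⁻¹ • (E k n * Ki i) := by
  have e := congrArg (fun T => Ki i * T * Ki i) (h.cKE hq0 hP i k n)
  simp only [mul_smul_comm, smul_mul_assoc] at e
  have e1 : Ki i * (K i * E k n) * Ki i = E k n * Ki i := by
    rw [← mul_assoc (Ki i), h.cKiK hq0 hP, one_mul]
  have e2 : Ki i * (E k n * K i) * Ki i = Ki i * E k n := by
    rw [mul_assoc, mul_assoc (E k n), h.cKKi hq0 hP, mul_one]
  rw [e1, e2] at e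
  rw [e, smul_smul, inv_mul_cancel₀ (zpow_ne_zero _ hq0), one_smul]

theorem Act.cDE (hq0 : q ≠ 0) (hP : Pres q M N pl V X) (h : Act q M N pl X κ K Ki D E)
    (i k : Idx M N) (s n : ℤ) :
    D i s * E k n - E k n * D i s = dco q M (!pl) i.1 k.1 s • E k (n + s) := by
  rw [dco_not]
  apply hP.ext
  · simp [h.D1, h.E1]
  · intro j m v hv
    have hΦ : D i s (Ph q K Ki D k (n + m) v) = Ph q K Ki D k (n + m) (D i s v) :=
      LinearMap.congr_fun (Ph_comm (h.cKH hP k i s).symm (h.cKiH hq0 hP k i s).symm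
        (fun t => h.cHH hP i k s t) (n + m)) v
    simp only [Module.End.mul_apply, LinearMap.sub_apply, LinearMap.smul_apply, h.DX, h.EX,
      map_smul, map_add, smul_add] at *
    have hv' : D i s (E k n v) = E k n (D i s v) + -dco q M pl i.1 k.1 s • E k (n + s) v := by
      rw [← hv]; abel
    rw [hv', mul_add, mul_smul_comm]
    by_cases hj : j = k
    · subst hj
      simp only [if_true, map_smul, hΦ]
      rw [show n + (m + s) = n + s + m by ring]
      module
    · simp only [hj, if_false, map_zero]
      module

theorem Act.satE (hq0 : q ≠ 0) (hq1 : ∀ k : ℕ, k ≠ 0 → q ^ k ≠ 1) (hP : Pres q M N pl V X)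
    (h : Act q M N pl X κ K Ki D E) : Sat q M N (!pl) E :=
  hP.opp hq0 κ h.E1 h.EX (Ph_good hq0 hq1 (h.cKE hq0 hP) (h.cKiE hq0 hP) (h.cDE hq0 hP))

end act
end QAS

set_option linter.all false
set_option linter.unusedSectionVars false
set_option linter.unusedSimpArgs false
namespace QAS

section rep
variable {q : ℂ} {M N : ℕ} {A : Type} [Ring A] [Algebra ℂ A]

/-- images of the generators. -/
def gmap (xp xm : Idx M N → ℤ → A) (K Ki : Idx M N → A) (D : Idx M N → ℤ → A) :
    Gen M N false → A
  | Gen.Xp i n => xp i n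
  | Gen.Xm i n => xm i n
  | Gen.K i => K i
  | Gen.Ki i => Ki i
  | Gen.H i s => D i s.1
  | Gen.K0 _ => 0
  | Gen.K0i _ => 0

theorem ev_XgF (x : Idx M N → ℤ → A) (i : Idx M N) (n : ℤ) : ev x (XgF M N i.1 n) = x i n := by
  rw [XgF, dif_pos i.2, ev_ι]

theorem map_oscOf {A B : Type} [Ring A] [Algebra ℂ A] [Ring B] [Algebra ℂ B] (f : A →ₐ[ℂ] B) (q : ℂ)
    (M : ℕ) (X : ℕ → ℤ → A) (m n k u : ℤ) :
    f (oscOf q M X m n k u) = oscOf q M (fun i n => f (X i n)) m n k u := by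
  simp [oscOf, brF]

theorem ex_rep (xp xm : Idx M N → ℤ → A) (K Ki : Idx M N → A) (D : Idx M N → ℤ → A)
    (hp : Sat q M N true xp) (hm : Sat q M N false xm)
    (cKKi : ∀ i, K i * Ki i = 1) (cKiK : ∀ i, Ki i * K i = 1)
    (cKK : ∀ i j, K i * K j = K j * K i) (cKiK2 : ∀ i j, Ki i * K j = K j * Ki i)
    (cKiKi : ∀ i j, Ki i * Ki j = Ki j * Ki i)
    (cKH : ∀ i j s, K i * D j s = D j s * K i) (cKiH : ∀ i j s, Ki i * D j s = D j s * Ki i)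
    (cHH : ∀ i j s t, D i s * D j t = D j t * D i s)
    (cKp : ∀ i j n, K i * xp j n = (q ^ ce M true i.1 j.1) • (xp j n * K i))
    (cKm : ∀ i j n, K i * xm j n = (q ^ ce M false i.1 j.1) • (xm j n * K i))
    (cDp : ∀ i j s n, D i s * xp j n - xp j n * D i s = dco q M true i.1 j.1 s • xp j (n + s))
    (cDm : ∀ i j s n, D i s * xm j n - xm j n * D i s = dco q M false i.1 j.1 s • xm j (n + s))
    (cpm : ∀ i j m n, xp i m * xm j n - sgn M i.1 j.1 • (xm j n * xp i m) =
      if i = j then (tq q M i.1)⁻¹ • Ph q K Ki D i (m + n) else 0) :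
    ∃ ρ : ALG q M N false 3 →ₐ[ℂ] A, (∀ i n, ρ (mkA q M N false 3 (gi (Gen.Xp i n))) = xp i n) ∧
      (∀ i n, ρ (mkA q M N false 3 (gi (Gen.Xm i n))) = xm i n) := by
  set F : FA M N false →ₐ[ℂ] A := FreeAlgebra.lift ℂ (gmap xp xm K Ki D) with hF
  have fXp : ∀ i n, F (gi (Gen.Xp i n)) = xp i n := fun i n => by simp [hF, gi, gmap]
  have fXm : ∀ i n, F (gi (Gen.Xm i n)) = xm i n := fun i n => by simp [hF, gi, gmap]
  have fK : ∀ i, F (gi (Gen.K i)) = K i := fun i => by simp [hF, gi, gmap]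
  have fKi : ∀ i, F (gi (Gen.Ki i)) = Ki i := fun i => by simp [hF, gi, gmap]
  have fH : ∀ i s, F (gi (Gen.H i s)) = D i s.1 := fun i s => by simp [hF, gi, gmap]
  have fP : ∀ (i : Idx M N) n, F (phiPF q M N false i.1 n) = phP (tq q M i.1) (K i) (D i) n := by
    intro i n
    unfold phiPF phP
    split_ifs
    · rw [map_mul, map_expC, KF, dif_pos i.2, fK]
      congr 1
      apply expC_congr
      intro s
      rw [HF, dif_pos ⟨i.2, by omega⟩, fH]
    · simp
  have fM : ∀ (i : Idx M N) n, F (phiMF q M N false i.1 n) = phM (tq q M i.1) (Ki i) (D i) n := by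
    intro i n
    unfold phiMF phM
    split_ifs
    · rw [map_mul, map_expC, KiF, dif_pos i.2, fKi]
      congr 1
      apply expC_congr
      intro s
      rw [HF, dif_pos ⟨i.2, by omega⟩, fH]
    · simp
  have fXp' : ∀ i n, F (XpF M N false i n) = ev xp (XgF M N i n) := by
    intro i n
    unfold XpF XgF
    split_ifs with h
    · rw [fXp, ev_ι]
    · simp
  have fXm' : ∀ i n, F (XmF M N false i n) = ev xm (XgF M N i n) := by
    intro i n
    unfold XmF XgF
    split_ifs with h
    · rw [fXm, ev_ι]
    · simp
  have key : ∀ ⦃a b⦄, rel q M N false 3 a b → F a = F b := by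
    intro a b hab
    cases hab with
    | KKi i => simp [fK, fKi, cKKi]
    | KiK i => simp [fK, fKi, cKiK]
    | KK i j => simp only [map_mul, fK]; exact cKK i j
    | KKi2 i j => simp only [map_mul, fK, fKi]; exact (cKiK2 j i).symm
    | KiKi i j => simp only [map_mul, fKi]; exact cKiKi i j
    | KH i j s => simp only [map_mul, fK, fH]; exact cKH i j s
    | KiH i j s => simp only [map_mul, fKi, fH]; exact cKiH i j s
    | HH i j s t => simp only [map_mul, fH]; exact cHH i j s t
    | KXp i j n => simp only [map_mul, map_smul, fK, fXp]; exact cKp i j n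
    | KXm i j n => simp only [map_mul, map_smul, fK, fXm]; exact cKm i j n
    | HXp i j s n =>
      simp only [map_mul, map_sub, map_smul, fH, fXp]
      rw [cDp]; simp [dco]
    | HXm i j s n =>
      simp only [map_mul, map_sub, map_neg, map_smul, fH, fXm]
      rw [cDm]; simp [dco]
    | XpXm i j m n =>
      simp only [map_mul, map_sub, map_smul, fXp, fXm]
      rw [cpm]
      split_ifs
      · rw [map_smul, map_sub, fP, fM]; rfl
      · simp
    | XX0p i j m n h2 h =>
      have := hp _ _ (rel1.comm0 i j m n h)
      simpa only [map_mul, map_sub, map_smul, map_zero, fXp, ev_ι, un] using this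
    | XX0m i j m n h2 h =>
      have := hm _ _ (rel1.comm0 i j m n h)
      simpa only [map_mul, map_sub, map_smul, map_zero, fXm, ev_ι, un] using this
    | XXp i j m n h2 h =>
      have := hp _ _ (rel1.deg2 i j m n h)
      simpa only [map_mul, map_sub, map_smul, map_zero, fXp, ev_ι, un, if_true] using this
    | XXm i j m n h2 h =>
      have := hm _ _ (rel1.deg2 i j m n h)
      simpa [fXm, un] using this
    | serreP i j m n k h3 h hi =>
      have := hp _ _ (rel1.serre i j m n k h hi)
      simpa only [map_add, map_brF, map_zero, fXp, ev_ι, un] using this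
    | serreM i j m n k h3 h hi =>
      have := hm _ _ (rel1.serre i j m n k h hi)
      simpa only [map_add, map_brF, map_zero, fXm, ev_ι, un] using this
    | oscP m n k u h3 hM hN =>
      have := hp _ _ (rel1.osc m n k u hM hN)
      simpa only [map_add, map_oscOf, map_zero, fXp'] using this
    | oscM m n k u h3 hM hN =>
      have := hm _ _ (rel1.osc m n k u hM hN)
      simpa only [map_add, map_oscOf, map_zero, fXm'] using this
    | K0K0i he => exact absurd he (by simp)
    | K0iK0 he => exact absurd he (by simp)
    | K0K he => exact absurd he (by simp)
    | K0Ki he => exact absurd he (by simp)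
    | K0H he => exact absurd he (by simp)
    | K0Xp he => exact absurd he (by simp)
    | K0Xm he => exact absurd he (by simp)
  refine ⟨RingQuot.liftAlgHom ℂ ⟨F, key⟩, ?_, ?_⟩
  · intro i n
    rw [mkA, RingQuot.liftAlgHom_mkAlgHom_apply, fXp]
  · intro i n
    rw [mkA, RingQuot.liftAlgHom_mkAlgHom_apply, fXm]
end rep

section fin
variable {q : ℂ} {M N : ℕ}

/-- generators of the presented algebra. -/
def Xq (q : ℂ) (M N : ℕ) (pl : Bool) (i : Idx M N) (m : ℤ) : RingQuot (rel1 q M N pl) :=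
  RingQuot.mkAlgHom ℂ (rel1 q M N pl) (FreeAlgebra.ι ℂ (i, m))

theorem ev_Xq (pl : Bool) : ev (Xq q M N pl) = RingQuot.mkAlgHom ℂ (rel1 q M N pl) := by
  apply FreeAlgebra.hom_ext
  funext g
  simp [un, Xq]

theorem pres_Xq (pl : Bool) : Pres q M N pl (RingQuot (rel1 q M N pl)) (Xq q M N pl) where
  sat := fun a b hab => by rw [ev_Xq]; exact RingQuot.mkAlgHom_rel ℂ hab
  ind := by
    intro S h1 h
    have key : ∀ a : FreeAlgebra ℂ (Idx M N × ℤ), ∀ v ∈ S, ev (Xq q M N pl) a * v ∈ S := by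
      intro a
      induction a using FreeAlgebra.induction with
      | grade0 r =>
        intro v hv
        rw [AlgHom.commutes, ← Algebra.smul_def]
        exact S.smul_mem _ hv
      | grade1 g => intro v hv; rw [ev_ι]; exact h _ _ _ hv
      | mul a b ha hb => intro v hv; rw [map_mul, mul_assoc]; exact ha _ (hb _ hv)
      | add a b ha hb => intro v hv; rw [map_add, add_mul]; exact S.add_mem (ha _ hv) (hb _ hv)
    rw [eq_top_iff]
    intro v _
    obtain ⟨a, rfl⟩ := RingQuot.mkAlgHom_surjective ℂ (rel1 q M N pl) v
    have := key a 1 h1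
    rwa [ev_Xq, mul_one] at this
  lift := by
    intro A _ _ x hx
    exact ⟨RingQuot.liftAlgHom ℂ ⟨ev x, fun a b hab => hx a b hab⟩, fun i m => by
      rw [Xq, RingQuot.liftAlgHom_mkAlgHom_apply, ev_ι]⟩

/-- the generators of the big algebra. -/
def XA (q : ℂ) (M N : ℕ) (pl : Bool) (i : Idx M N) (m : ℤ) : ALG q M N false 3 :=
  mkA q M N false 3 (if pl then gi (Gen.Xp i m) else gi (Gen.Xm i m))

def XAn (q : ℂ) (M N : ℕ) (pl : Bool) (i : ℕ) (m : ℤ) : ALG q M N false 3 :=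
  if pl then XpA q M N false 3 i m else XmA q M N false 3 i m

theorem ev_XA (pl : Bool) (i : ℕ) (n : ℤ) : ev (XA q M N pl) (XgF M N i n) = XAn q M N pl i n := by
  unfold XgF XAn XpA XmA XpF XmF
  split_ifs with h
  · rw [ev_ι]; simp_all [un, XA]
  · rw [ev_ι]; simp_all [un, XA]
  · simp
  · simp

theorem sat_XA (pl : Bool) : Sat q M N pl (XA q M N pl) := by
  intro a b hab
  have R : ∀ {a b}, rel q M N false 3 a b → mkA q M N false 3 a = mkA q M N false 3 b :=
    fun h => RingQuot.mkAlgHom_rel ℂ h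
  cases pl with
  | true =>
    cases hab with
    | comm0 i j m n h =>
      have := R (rel.XX0p i j m n (by norm_num) h)
      simpa [un, XA] using this
    | deg2 i j m n h =>
      have := R (rel.XXp i j m n (by norm_num) h)
      simpa [un, XA] using this
    | serre i j m n k h hi =>
      have := R (rel.serreP i j m n k (by norm_num) h hi)
      simpa [un, XA, map_brF] using this
    | osc m n k u hM hN =>
      have := R (rel.oscP m n k u (by norm_num) hM hN)
      simp only [map_add, map_oscOf, map_zero, ev_XA] at this ⊢
      exact this
  | false =>
    cases hab with
    | comm0 i j m n h =>
      have := R (rel.XX0m i j m n (by norm_num) h)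
      simpa [un, XA] using this
    | deg2 i j m n h =>
      have := R (rel.XXm i j m n (by norm_num) h)
      simpa [un, XA] using this
    | serre i j m n k h hi =>
      have := R (rel.serreM i j m n k (by norm_num) h hi)
      simpa [un, XA, map_brF] using this
    | osc m n k u hM hN =>
      have := R (rel.oscM m n k u (by norm_num) hM hN)
      simp only [map_add, map_oscOf, map_zero, ev_XA] at this ⊢
      exact this

theorem ex_action (hq0 : q ≠ 0) (hq1 : ∀ k : ℕ, k ≠ 0 → q ^ k ≠ 1) (pl : Bool) :
    ∃ ρ : ALG q M N false 3 →ₐ[ℂ] Module.End ℂ (RingQuot (rel1 q M N pl)),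
      ∀ i m, ρ (XA q M N pl i m) = Lm (Xq q M N pl) i m := by
  have hP := pres_Xq (q := q) (M := M) (N := N) pl
  obtain ⟨K, Ki, D, E, h⟩ := hP.ex_act hq0 hq1
    (fun k => if pl then -(sgn M k.1 k.1 * (tq q M k.1)⁻¹) else (tq q M k.1)⁻¹)
  have cK : ∀ i j n, K i * Lm (Xq q M N pl) j n =
      (q ^ ce M pl i.1 j.1) • (Lm (Xq q M N pl) j n * K i) := by
    intro i j n; ext v; exact h.KX i j n v
  have cD : ∀ i j s n, D i s * Lm (Xq q M N pl) j n - Lm (Xq q M N pl) j n * D i s =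
      dco q M pl i.1 j.1 s • Lm (Xq q M N pl) j (n + s) := by
    intro i j s n; ext v
    simp only [LinearMap.sub_apply, Module.End.mul_apply, Lm_apply, LinearMap.smul_apply, h.DX]
    simp
  have hE := h.satE hq0 hq1 hP
  have cKE := h.cKE hq0 hP
  have cDE := h.cDE hq0 hP
  cases pl with
  | true =>
    obtain ⟨ρ, h1, h2⟩ := ex_rep (q := q) (Lm (Xq q M N true)) E K Ki D hP.satL hE
      (h.cKKi hq0 hP) (h.cKiK hq0 hP) (h.cKK hP) (h.cKiKj hq0 hP) (h.cKiKi hq0 hP) (h.cKH hP)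
      (h.cKiH hq0 hP) (h.cHH hP) cK cKE cD cDE (by
        intro i j m n
        ext v
        simp only [LinearMap.sub_apply, Module.End.mul_apply, Lm_apply, LinearMap.smul_apply, h.EX]
        rw [sgn_symm M j.1 i.1, smul_add, smul_smul, sgn_sq, one_smul]
        by_cases hij : i = j
        · subst hij
          simp only [if_true, LinearMap.smul_apply, smul_smul, add_comm n m, mul_neg, ← mul_assoc,
            sgn_sq, one_mul]
          module
        · simp [hij])
    exact ⟨ρ, fun i m => by simpa [XA] using h1 i m⟩
  | false =>
    obtain ⟨ρ, h1, h2⟩ := ex_rep (q := q) E (Lm (Xq q M N false)) K Ki D hE hP.satL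
      (h.cKKi hq0 hP) (h.cKiK hq0 hP) (h.cKK hP) (h.cKiKj hq0 hP) (h.cKiKi hq0 hP) (h.cKH hP)
      (h.cKiH hq0 hP) (h.cHH hP) cKE cK cDE cD (by
        intro i j m n
        ext v
        simp only [LinearMap.sub_apply, Module.End.mul_apply, Lm_apply, LinearMap.smul_apply, h.EX]
        by_cases hij : i = j
        · subst hij
          simp
        · simp [hij, Ne.symm hij])
    exact ⟨ρ, fun i m => by simpa [XA] using h2 i m⟩

theorem final (hq0 : q ≠ 0) (hq1 : ∀ k : ℕ, k ≠ 0 → q ^ k ≠ 1) (pl : Bool) :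
    ∃ φ : RingQuot (rel1 q M N pl) →ₐ[ℂ] ALG q M N false 3,
      (∀ (i : ℕ) (n : ℤ),
        φ (RingQuot.mkAlgHom ℂ (rel1 q M N pl) (XgF M N i n)) = XAn q M N pl i n) ∧
      Function.Injective φ ∧
        φ.range = Algebra.adjoin ℂ {x | ∃ i : ℕ, ∃ n : ℤ, x = XAn q M N pl i n} := by
  have hP := pres_Xq (q := q) (M := M) (N := N) pl
  obtain ⟨φ, hφ⟩ := hP.lift _ _ (sat_XA pl)
  obtain ⟨ρ, hρ⟩ := ex_action (M := M) (N := N) hq0 hq1 pl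
  have e1 : ∀ a, φ (RingQuot.mkAlgHom ℂ (rel1 q M N pl) a) = ev (XA q M N pl) a := by
    intro a
    have : φ.comp (RingQuot.mkAlgHom ℂ (rel1 q M N pl)) = ev (XA q M N pl) := by
      apply FreeAlgebra.hom_ext
      funext g
      obtain ⟨i, m⟩ := g
      simpa [un, Xq] using hφ i m
    exact DFunLike.congr_fun this a
  have h1 : ∀ (i : ℕ) (n : ℤ),
      φ (RingQuot.mkAlgHom ℂ (rel1 q M N pl) (XgF M N i n)) = XAn q M N pl i n :=
    fun i n => by rw [e1, ev_XA]
  refine ⟨φ, h1, ?_, ?_⟩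
  · have e : ∀ v, ρ (φ v) = Algebra.lmul ℂ _ v := by
      let S : Submodule ℂ (RingQuot (rel1 q M N pl)) :=
        { carrier := {v | ρ (φ v) = Algebra.lmul ℂ (RingQuot (rel1 q M N pl)) v}
          add_mem' := by
            intro a b ha hb
            simp only [Set.mem_setOf_eq] at ha hb ⊢
            rw [map_add, map_add, map_add, ha, hb]
          zero_mem' := by
            simp only [Set.mem_setOf_eq]
            rw [map_zero, map_zero, map_zero]
          smul_mem' := by
            intro c a ha
            simp only [Set.mem_setOf_eq] at ha ⊢
            rw [map_smul, map_smul, map_smul, ha] }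
      have hS : S = ⊤ := hP.ind S
        (by
          change ρ (φ 1) = Algebra.lmul ℂ (RingQuot (rel1 q M N pl)) 1
          rw [map_one φ, map_one ρ, map_one])
        (by
          intro i m v hv
          change ρ (φ v) = Algebra.lmul ℂ (RingQuot (rel1 q M N pl)) v at hv
          change ρ (φ (Xq q M N pl i m * v)) =
            Algebra.lmul ℂ (RingQuot (rel1 q M N pl)) (Xq q M N pl i m * v)
          rw [map_mul φ, map_mul ρ, hv, hφ, hρ, map_mul]; rfl)
      intro v
      have hv : v ∈ S := by rw [hS]; trivial
      exact hv
    intro v w hvw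
    have h2 : Algebra.lmul ℂ _ v = Algebra.lmul ℂ _ w := by rw [← e, ← e, hvw]
    have h3 := LinearMap.congr_fun h2 1
    simpa using h3
  · apply le_antisymm
    · rintro _ ⟨v, rfl⟩
      obtain ⟨a, rfl⟩ := RingQuot.mkAlgHom_surjective ℂ (rel1 q M N pl) v
      change φ (RingQuot.mkAlgHom ℂ (rel1 q M N pl) a) ∈ _
      rw [e1]
      induction a using FreeAlgebra.induction with
      | grade0 r => rw [AlgHom.commutes]; exact Subalgebra.algebraMap_mem _ r
      | grade1 g =>
        apply Algebra.subset_adjoin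
        refine ⟨g.1.1, g.2, ?_⟩
        rw [← ev_XA, ev_XgF, ev_ι]
      | mul a b ha hb => rw [map_mul]; exact Subalgebra.mul_mem _ ha hb
      | add a b ha hb => rw [map_add]; exact Subalgebra.add_mem _ ha hb
    · apply Algebra.adjoin_le
      rintro _ ⟨i, n, rfl⟩
      exact ⟨_, h1 i n⟩
end fin
end QAS


open QAS in
/-- `U⁺` (resp. `U⁻`) is isomorphic, via the canonical map sending generator
to generator, to the superalgebra presented by the `X⁺_{i,n}` (resp. `X⁻_{i,n}`) and
relations (R4)–(R7) with the `+` (resp. `−`) sign. -/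
theorem presentation_of_Uplus_Uminus (q : ℂ) (hq0 : q ≠ 0)
    (hq1 : ∀ k : ℕ, k ≠ 0 → q ^ k ≠ 1) (M N : ℕ) (hM : 1 ≤ M) (hN : 1 ≤ N) :
    (∃ φ : RingQuot (rel1 q M N true) →ₐ[ℂ] ALG q M N false 3,
      (∀ (i : ℕ) (n : ℤ),
        φ (RingQuot.mkAlgHom ℂ (rel1 q M N true) (XgF M N i n)) = XpA q M N false 3 i n) ∧
      Function.Injective φ ∧ φ.range = Aplus q M N false 3) ∧
    (∃ ψ : RingQuot (rel1 q M N false) →ₐ[ℂ] ALG q M N false 3,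
      (∀ (i : ℕ) (n : ℤ),
        ψ (RingQuot.mkAlgHom ℂ (rel1 q M N false) (XgF M N i n)) = XmA q M N false 3 i n) ∧
      Function.Injective ψ ∧ ψ.range = Aminus q M N false 3) := by
  refine ⟨?_, ?_⟩
  · obtain ⟨φ, h1, h2, h3⟩ := final (M := M) (N := N) hq0 hq1 true
    exact ⟨φ, h1, h2, h3⟩
  · obtain ⟨φ, h1, h2, h3⟩ := final (M := M) (N := N) hq0 hq1 false
    exact ⟨φ, h1, h2, h3⟩
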